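/- arXiv:1803.02415 — 2 statements merged into one kernel-verified Lean document; each statement's English description precedes it below -/
import Mathlib

section
/- Let B ⊆ ℝ^{d_β} be open with β₀ ∈ B, and let Π be the disjoint union of a finite or countable family of second-countable Hausdorff C¹ manifolds (without boundary). Let h : B × Π → ℝ^{d_h} be such that: β ↦ h(β,π) is twice continuously differentiable for each π, with derivative in β denoted h_β(β,π); the maps (β,π) ↦ h(β,π) and (β,π) ↦ h_β(β,π) are continuous; and for each β ∈ B the maps π ↦ h(β,π) and π ↦ h_β(β₀,π) are continuously differentiable on each component of Π. Let π₀ ∈ Π, b ∈ ℝ^{d_β}, and let (β_n) be a sequence in B with β_n → β₀ and √n·(h(β_n,π) − h(β₀,π)) → h_β(β₀,π)b uniformly on compact subsets of Π. Assume that for Lebesgue-almost every β ∈ B the map π ↦ h(β,π) − h(β₀,π) is injective on Π. Then for every z₁ ∈ ℝ^{d_β}, the set of z₂ ∈ ℝ^{d_h} for which the equation h_β(β₀,π)(z₁ − b) = z₂ − h_β(β₀,π₀)b has more than one solution π ∈ Π has Lebesgue measure zero in ℝ^{d_h}. -/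
open MeasureTheory
open scoped Manifold

/-- Near the identity the determinant is positive. -/
theorem exists_pos_det_one_add {E : Type*} [NormedAddCommGroup E] [NormedSpace ℝ E]
    [FiniteDimensional ℝ E] :
    ∃ ε > 0, ∀ A : E →L[ℝ] E, ‖A‖ < ε → 0 < (1 + A).det := by
  have hc : Continuous fun A : E →L[ℝ] E => (1 + A).det :=
    ContinuousLinearMap.continuous_det.comp (continuous_const.add continuous_id)
  have h0 : 0 < ((1 : E →L[ℝ] E) + 0).det := by
    simp [ContinuousLinearMap.det]
  obtain ⟨ε, hε, h⟩ := Metric.eventually_nhds_iff.1 (hc.continuousAt.eventually_const_lt h0)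
  exact ⟨ε, hε, fun A hA => h (by simpa using hA)⟩

/-- The value of `det` at `A` is a fixed linear combination of determinants of large shifts
of `A`. -/
theorem exists_det_eq_sum_det_smul_one_add (E : Type*) [NormedAddCommGroup E] [NormedSpace ℝ E]
    [FiniteDimensional ℝ E] (c : ℝ) :
    ∃ (s : Finset ℕ) (v w : ℕ → ℝ), (∀ i, c < v i) ∧
      ∀ A : E →L[ℝ] E, A.det = ∑ i ∈ s, w i * (v i • (1 : E →L[ℝ] E) + A).det := by
  set s := Finset.range (Module.finrank ℝ E + 1) with hs
  set v : ℕ → ℝ := fun i => c + 1 + i with hv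
  have hvs : Set.InjOn v s := fun i _ j _ hij => by simpa [hv] using hij
  refine ⟨s, v, fun i => (Lagrange.basis s v i).eval 0, fun i => ?_, fun A => ?_⟩
  · simp only [hv]
    have : (0 : ℝ) ≤ i := Nat.cast_nonneg i
    linarith
  have key : ∀ t : ℝ, (t • (1 : E →L[ℝ] E) + A).det
      = ((-A : E →L[ℝ] E) : E →ₗ[ℝ] E).charpoly.eval t := by
    intro t
    rw [LinearMap.eval_charpoly, ContinuousLinearMap.det]
    congr 1
    ext x
    simp
  have hdeg : ((-A : E →L[ℝ] E) : E →ₗ[ℝ] E).charpoly.degree < s.card := by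
    refine Polynomial.degree_le_natDegree.trans_lt ?_
    rw [LinearMap.charpoly_natDegree]
    simp [hs]
    exact_mod_cast Nat.lt_succ_self _
  have h0 : A.det = ((-A : E →L[ℝ] E) : E →ₗ[ℝ] E).charpoly.eval 0 := by
    rw [← key]; simp
  rw [h0, Lagrange.eq_interpolate hvs hdeg, Lagrange.interpolate_apply, Polynomial.eval_finsetSum]
  refine Finset.sum_congr rfl fun i _ => ?_
  rw [key]
  simp [mul_comm]

/-- A Lipschitz map becomes bijective after adding a large multiple of the identity. -/
theorem bijective_smul_add_of_lipschitz {E : Type*} [NormedAddCommGroup E] [NormedSpace ℝ E]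
    [FiniteDimensional ℝ E] {F : E → E} {L : NNReal} (hF : LipschitzWith L F) {c : ℝ}
    (hc : L < c) : Function.Bijective fun x => c • x + F x := by
  have hc0 : 0 < c := L.coe_nonneg.trans_lt hc
  let e : E ≃L[ℝ] E := ContinuousLinearEquiv.smulLeft (Units.mk0 c hc0.ne')
  have he : ∀ x, e x = c • x := fun x => rfl
  have hes : ∀ x, e.symm x = c⁻¹ • x := fun x => by
    rw [ContinuousLinearEquiv.symm_apply_eq, he, smul_inv_smul₀ hc0.ne']
  have happ : ApproximatesLinearOn (fun x => c • x + F x) (e : E →L[ℝ] E) Set.univ L := by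
    rw [ApproximatesLinearOn.approximatesLinearOn_iff_lipschitzOnWith, lipschitzOnWith_univ]
    convert hF using 1
    ext x
    simp [he]
  have hN : Subsingleton E ∨ L < ‖(e.symm : E →L[ℝ] E)‖₊⁻¹ := by
    rcases subsingleton_or_nontrivial E with h | h
    · exact Or.inl h
    right
    have : (e.symm : E →L[ℝ] E) = c⁻¹ • 1 := by
      ext x; simp [hes]
    rw [← NNReal.coe_lt_coe]
    simpa [this, norm_smul, abs_of_pos hc0] using hc
  exact ⟨Set.injOn_univ.1 (happ.injOn hN), happ.surjective hN⟩

/-- Two maps that agree off a compact set have, for large shifts, the same integrated Jacobian. -/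
theorem setIntegral_det_smul_one_add_eq {E : Type*} [NormedAddCommGroup E] [NormedSpace ℝ E]
    [FiniteDimensional ℝ E] [MeasurableSpace E] [BorelSpace E] (μ : Measure E)
    [μ.IsAddHaarMeasure] {F G : E → E} {F' G' : E → E →L[ℝ] E}
    (hF : ∀ x, HasFDerivAt F (F' x) x) (hG : ∀ x, HasFDerivAt G (G' x) x)
    {L : NNReal} (hFL : LipschitzWith L F) (hGL : LipschitzWith L G)
    {K : Set E} (hK : IsCompact K) (hFG : ∀ x ∉ K, F x = G x) :
    ∃ c₀ : ℝ, ∀ c > c₀, ∫ x in K, (c • (1 : E →L[ℝ] E) + F' x).det ∂μ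
      = ∫ x in K, (c • (1 : E →L[ℝ] E) + G' x).det ∂μ := by
  obtain ⟨ε, hε, hdet⟩ := exists_pos_det_one_add (E := E)
  refine ⟨max L (L / ε), fun c hc => ?_⟩
  have hcL : L < c := (le_max_left _ _).trans_lt hc
  have hc0 : 0 < c := L.coe_nonneg.trans_lt hcL
  have hcε : L < c * ε := (div_lt_iff₀ hε).1 ((le_max_right _ _).trans_lt hc)
  have hpos : ∀ A : E →L[ℝ] E, ‖A‖ ≤ L → 0 < (c • (1 : E →L[ℝ] E) + A).det := by
    intro A hA
    have h1 : c • (1 : E →L[ℝ] E) + A = c • (1 + c⁻¹ • A) := by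
      rw [smul_add, smul_inv_smul₀ hc0.ne']
    have h2 : (c • (1 + c⁻¹ • A)).det
        = c ^ Module.finrank ℝ E * (1 + c⁻¹ • A : E →L[ℝ] E).det := by
      simp only [ContinuousLinearMap.det, ContinuousLinearMap.toLinearMap_smul, LinearMap.det_smul]
    rw [h1, h2]
    refine mul_pos (pow_pos hc0 _) (hdet _ ?_)
    rw [norm_smul, norm_inv, Real.norm_of_nonneg hc0.le, inv_mul_lt_iff₀ hc0]
    exact hA.trans_lt hcε
  have hvol : ∀ {H : E → E} {H' : E → E →L[ℝ] E}, (∀ x, HasFDerivAt H (H' x) x) →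
      LipschitzWith L H → ∫ x in K, (c • (1 : E →L[ℝ] E) + H' x).det ∂μ
        = ∫ _x in (fun x => c • x + H x) '' K, (1 : ℝ) ∂μ := by
    intro H H' hH hHL
    rw [integral_image_eq_integral_abs_det_fderiv_smul μ hK.measurableSet
      (f := fun x => c • x + H x) (f' := fun x => c • (1 : E →L[ℝ] E) + H' x)
      (fun x _ => (((hasFDerivAt_id x).const_smul c).add (hH x)).hasFDerivWithinAt)
      (bijective_smul_add_of_lipschitz hHL hcL).injective.injOn]
    refine setIntegral_congr_fun hK.measurableSet fun x _ => ?_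
    simp [abs_of_pos (hpos _ ((hH x).le_of_lipschitz hHL))]
  have himg : ∀ {H₁ H₂ : E → E}, LipschitzWith L H₁ → LipschitzWith L H₂ →
      (∀ x ∉ K, H₁ x = H₂ x) →
      (fun x => c • x + H₁ x) '' K ⊆ (fun x => c • x + H₂ x) '' K := by
    rintro H₁ H₂ h₁ h₂ h₁₂ _ ⟨x, hx, rfl⟩
    obtain ⟨y, hy⟩ := (bijective_smul_add_of_lipschitz h₂ hcL).surjective (c • x + H₁ x)
    refine ⟨y, ?_, hy⟩
    by_contra hyK
    have : y = x := (bijective_smul_add_of_lipschitz h₁ hcL).injective (by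
      simpa [h₁₂ y hyK] using hy)
    exact hyK (this ▸ hx)
  rw [hvol hF hFL, hvol hG hGL,
    (himg hFL hGL hFG).antisymm (himg hGL hFL fun x hx => (hFG x hx).symm)]

/-- The integral of the Jacobian determinant depends only on the values of the map off a
compact set. -/
theorem setIntegral_det_eq_of_eq_off_compact {E : Type*} [NormedAddCommGroup E]
    [NormedSpace ℝ E] [FiniteDimensional ℝ E] [MeasurableSpace E] [BorelSpace E] (μ : Measure E)
    [μ.IsAddHaarMeasure] {F G : E → E} {F' G' : E → E →L[ℝ] E}
    (hF : ∀ x, HasFDerivAt F (F' x) x) (hG : ∀ x, HasFDerivAt G (G' x) x)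
    (hF' : Continuous F') (hG' : Continuous G')
    {L : NNReal} (hFL : LipschitzWith L F) (hGL : LipschitzWith L G)
    {K : Set E} (hK : IsCompact K) (hFG : ∀ x ∉ K, F x = G x) :
    ∫ x in K, (F' x).det ∂μ = ∫ x in K, (G' x).det ∂μ := by
  obtain ⟨c₀, hc₀⟩ := setIntegral_det_smul_one_add_eq μ hF hG hFL hGL hK hFG
  obtain ⟨s, v, w, hv, hdet⟩ := exists_det_eq_sum_det_smul_one_add E c₀
  have hint : ∀ {H' : E → E →L[ℝ] E}, Continuous H' → ∀ i ∈ s,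
      Integrable (fun x => w i * (v i • (1 : E →L[ℝ] E) + H' x).det) (μ.restrict K) := by
    intro H' hH' i _
    refine (Continuous.continuousOn ?_).integrableOn_compact hK
    exact continuous_const.mul
      (ContinuousLinearMap.continuous_det.comp (continuous_const.add hH'))
  have hsum : ∀ {H' : E → E →L[ℝ] E}, Continuous H' → ∫ x in K, (H' x).det ∂μ
      = ∑ i ∈ s, w i * ∫ x in K, (v i • (1 : E →L[ℝ] E) + H' x).det ∂μ := by
    intro H' hH'
    simp_rw [hdet (H' _), integral_finsetSum s (hint hH'), integral_const_mul]
  rw [hsum hF', hsum hG']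
  exact Finset.sum_congr rfl fun i _ => by rw [hc₀ _ (hv i)]

/-- For every point `y` and radius `ε` there is a Lipschitz `C¹` map whose Jacobian determinant is
a nonnegative function, positive at `y` and supported in the `ε`-ball around `y`. -/
theorem exists_lipschitz_det_supported {ι : Type*} [Fintype ι] (y : ι → ℝ) {ε : ℝ} (hε : 0 < ε) :
    ∃ (T : (ι → ℝ) → ι → ℝ) (T' : (ι → ℝ) → (ι → ℝ) →L[ℝ] ι → ℝ),
      (∀ x, HasFDerivAt T (T' x) x) ∧ Continuous T' ∧ LipschitzWith 1 T ∧
      (∀ x, 0 ≤ (T' x).det) ∧ 0 < (T' y).det ∧ ∀ x, ε ≤ dist x y → (T' x).det = 0 := by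
  classical
  let φ : ContDiffBump (0 : ℝ) := ⟨ε / 2, ε, by positivity, by linarith⟩
  have hφ : Continuous φ := φ.continuous
  let τ : ℝ → ℝ := fun t => ∫ s in (0 : ℝ)..t, φ s
  have hτ : ∀ t, HasDerivAt τ (φ t) t := fun t =>
    intervalIntegral.integral_hasDerivAt_right (hφ.intervalIntegrable _ _)
      (hφ.stronglyMeasurableAtFilter _ _) hφ.continuousAt
  have hτL : LipschitzWith 1 τ := by
    refine lipschitzWith_of_nnnorm_deriv_le (fun t => (hτ t).differentiableAt) fun t => ?_
    rw [(hτ t).deriv, ← NNReal.coe_le_coe, coe_nnnorm, Real.norm_of_nonneg φ.nonneg]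
    exact φ.le_one
  let T' : (ι → ℝ) → (ι → ℝ) →L[ℝ] ι → ℝ := fun x =>
    ContinuousLinearMap.pi fun i =>
      φ (x i - y i) • (ContinuousLinearMap.proj i : (ι → ℝ) →L[ℝ] ℝ)
  have hdet : ∀ x, (T' x).det = ∏ i, φ (x i - y i) := by
    intro x
    have : ((T' x : (ι → ℝ) →L[ℝ] ι → ℝ) : (ι → ℝ) →ₗ[ℝ] ι → ℝ)
        = Matrix.toLin' (Matrix.diagonal fun i => φ (x i - y i)) := by
      ext v i
      simp [T', Matrix.mulVec_diagonal]
    rw [ContinuousLinearMap.det, this, LinearMap.det_toLin', Matrix.det_diagonal]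
  refine ⟨fun x i => τ (x i - y i), T', fun x => ?_, ?_, ?_, fun x => ?_, ?_, fun x hx => ?_⟩
  · rw [hasFDerivAt_pi]
    intro i
    exact (hτ (x i - y i)).comp_hasFDerivAt x
      (((ContinuousLinearMap.proj i : (ι → ℝ) →L[ℝ] ℝ).hasFDerivAt).sub_const (y i))
  · refine continuous_clm_apply.2 fun v => ?_
    refine continuous_pi fun i => ?_
    simp only [T', ContinuousLinearMap.pi_apply, smul_apply]
    fun_prop
  · refine LipschitzWith.of_dist_le_mul fun a b => ?_
    rw [NNReal.coe_one, one_mul, dist_pi_le_iff dist_nonneg]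
    intro i
    refine (hτL.dist_le_mul _ _).trans ?_
    simpa using dist_le_pi_dist a b i
  · rw [hdet]
    exact Finset.prod_nonneg fun i _ => φ.nonneg
  · rw [hdet]
    refine Finset.prod_pos fun i _ => ?_
    rw [sub_self, φ.one_of_mem_closedBall (Metric.mem_closedBall_self φ.rIn_pos.le)]
    exact one_pos
  · rw [hdet]
    by_contra hne
    rw [← ne_eq, Finset.prod_ne_zero_iff] at hne
    refine hx.not_gt ((dist_pi_lt_iff hε).2 fun i => ?_)
    have h1 : x i - y i ∈ Function.support φ := hne i (Finset.mem_univ i)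
    rw [φ.support_eq] at h1
    simpa [φ, Real.dist_eq] using h1

/-- A `C¹` self-map of `ℝⁿ` that is the identity off a compact set is onto. -/
theorem surjective_of_eq_id_off_compact {ι : Type*} [Fintype ι] {g : (ι → ℝ) → ι → ℝ}
    (hg : ContDiff ℝ 1 g) {L : NNReal} (hgL : LipschitzWith L g) {K : Set (ι → ℝ)}
    (hK : IsCompact K) (hgK : ∀ x ∉ K, g x = x) : Function.Surjective g := by
  by_contra hns
  obtain ⟨y, hy⟩ : ∃ y, ∀ x, g x ≠ y := by
    simpa [Function.Surjective] using hns
  set K₁ := K ∪ Metric.closedBall y 1 with hK₁def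
  have hK₁ : IsCompact K₁ := hK.union (isCompact_closedBall y 1)
  obtain ⟨ε, hε, hball⟩ : ∃ ε > 0, Metric.ball y ε ⊆ (g '' K₁)ᶜ :=
    Metric.isOpen_iff.1 (hK₁.image hg.continuous).isClosed.isOpen_compl y
      (by rintro ⟨x, -, hx⟩; exact hy x hx)
  obtain ⟨T, T', hT, hT'c, hTL, hnn, hpos, hzero⟩ := exists_lipschitz_det_supported y hε
  have hg' : ∀ x, HasFDerivAt g (fderiv ℝ g x) x := fun x =>
    (hg.differentiable one_ne_zero x).hasFDerivAt
  have hg'c : Continuous (fderiv ℝ g) := hg.continuous_fderiv one_ne_zero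
  have hcomp : ∀ x, HasFDerivAt (T ∘ g) ((T' (g x)).comp (fderiv ℝ g x)) x := fun x =>
    (hT (g x)).comp x (hg' x)
  have heq := setIntegral_det_eq_of_eq_off_compact volume hT hcomp hT'c
    ((hT'c.comp hg.continuous).clm_comp hg'c) (L := max 1 (1 * L))
    (hTL.weaken (le_max_left _ _)) ((hTL.comp hgL).weaken (le_max_right _ _)) hK₁
    (fun x hx => by
      rw [Function.comp_apply, hgK x fun h => hx (Or.inl h)])
  have hright : ∫ x in K₁, ((T' (g x)).comp (fderiv ℝ g x)).det = 0 := by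
    refine setIntegral_eq_zero_of_forall_eq_zero fun x hx => ?_
    have h1 : (T' (g x)).det = 0 := hzero _ (by
      by_contra hlt
      exact hball (Metric.mem_ball.2 (not_le.1 hlt)) ⟨x, hx, rfl⟩)
    simp only [ContinuousLinearMap.det, ContinuousLinearMap.toLinearMap_comp,
      LinearMap.det_comp] at h1 ⊢
    rw [h1, zero_mul]
  have hdetc : Continuous fun x => (T' x).det := ContinuousLinearMap.continuous_det.comp hT'c
  have hleft : 0 < ∫ x in K₁, (T' x).det := by
    rw [setIntegral_pos_iff_support_of_nonneg_ae (Filter.Eventually.of_forall hnn)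
      (hdetc.continuousOn.integrableOn_compact hK₁)]
    refine lt_of_lt_of_le ?_ (measure_mono (Set.inter_subset_inter_right _
      (Metric.ball_subset_closedBall.trans Set.subset_union_right)))
    exact (hdetc.isOpen_support.inter Metric.isOpen_ball).measure_pos volume
      ⟨y, hpos.ne', Metric.mem_ball_self one_pos⟩
  rw [heq, hright] at hleft
  exact hleft.false

/-- A `C¹` map uniformly close to the identity on a ball attains the centre of the ball. -/
theorem exists_eq_center_of_near_id {ι : Type*} [Fintype ι] {g : (ι → ℝ) → ι → ℝ} {z : ι → ℝ}
    {r : ℝ} (hr : 0 < r) (hg : ContDiffOn ℝ 1 g (Metric.ball z (3 * r)))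
    (hnear : ∀ x ∈ Metric.closedBall z (2 * r), ‖g x - x‖ ≤ r) :
    ∃ x ∈ Metric.closedBall z r, g x = z := by
  let χ : ContDiffBump z := ⟨r, 2 * r, hr, by linarith⟩
  have hχ0 : ∀ x ∉ Metric.closedBall z (2 * r), χ x = 0 := fun x hx =>
    χ.zero_of_le_dist (not_le.1 fun h => hx (Metric.mem_closedBall.2 h)).le
  set p : (ι → ℝ) → ι → ℝ := fun x => χ x • (g x - x) with hp
  have hp0 : ∀ x ∉ Metric.closedBall z (2 * r), p x = 0 := fun x hx => by
    simp [hp, hχ0 x hx]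
  have hpC : ContDiff ℝ 1 p := by
    rw [contDiff_iff_contDiffAt]
    intro x
    by_cases hx : x ∈ Metric.ball z (3 * r)
    · have h1 : ContDiffAt ℝ 1 g x := hg.contDiffAt (Metric.isOpen_ball.mem_nhds hx)
      exact χ.contDiffAt.smul (h1.sub contDiffAt_id)
    · have h2 : x ∈ (Metric.closedBall z (2 * r))ᶜ := fun h => hx
        (Metric.closedBall_subset_ball (by linarith) h)
      refine (contDiffAt_const (c := (0 : ι → ℝ))).congr_of_eventuallyEq ?_
      filter_upwards [Metric.isClosed_closedBall.isOpen_compl.mem_nhds h2] with w hw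
      exact hp0 w hw
  have hpK : HasCompactSupport p :=
    HasCompactSupport.intro (isCompact_closedBall z (2 * r)) hp0
  obtain ⟨C, hC⟩ := ContDiff.lipschitzWith_of_hasCompactSupport hpK hpC one_ne_zero
  obtain ⟨x, hx⟩ := surjective_of_eq_id_off_compact (contDiff_id.add hpC)
    (LipschitzWith.id.add hC) (isCompact_closedBall z (2 * r))
    (fun x hx => by simp [hp0 x hx]) z
  have hxz : x + p x = z := hx
  have hpx : ‖p x‖ ≤ r := by
    by_cases h : x ∈ Metric.closedBall z (2 * r)
    · rw [hp, norm_smul, Real.norm_of_nonneg χ.nonneg]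
      exact (mul_le_of_le_one_left (norm_nonneg _) χ.le_one).trans (hnear x h)
    · rw [hp0 x h, norm_zero]
      exact hr.le
  have hxr : x ∈ Metric.closedBall z r := by
    rw [mem_closedBall_iff_norm, ← hxz]
    simpa using hpx
  refine ⟨x, hxr, ?_⟩
  have h1 : χ x = 1 := χ.one_of_mem_closedBall hxr
  simpa [hp, h1] using hxz

/-- Inverse function theorem at a point where the derivative is the identity. -/
theorem exists_contDiffOn_rightInverse {E : Type*} [NormedAddCommGroup E] [NormedSpace ℝ E]
    [CompleteSpace E] {f : E → E} {a : E} (hf : ContDiffAt ℝ 1 f a)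
    (hf' : HasFDerivAt f (ContinuousLinearMap.id ℝ E) a) {W : Set E} (hW : W ∈ nhds a) :
    ∃ (V : Set E) (Ψ : E → E), IsOpen V ∧ f a ∈ V ∧ ContDiffOn ℝ 1 Ψ V ∧ Set.MapsTo Ψ V W ∧
      Ψ (f a) = a ∧ ∀ v ∈ V, f (Ψ v) = v := by
  have hf'' : HasFDerivAt f ((ContinuousLinearEquiv.refl ℝ E : E ≃L[ℝ] E) : E →L[ℝ] E) a := hf'
  set e := hf.toOpenPartialHomeomorph f hf'' one_ne_zero with he
  have hecoe : (e : E → E) = f := rfl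
  have hsrc : a ∈ e.source := hf.mem_toOpenPartialHomeomorph_source hf'' one_ne_zero
  have htgt : f a ∈ e.target := hf.image_mem_toOpenPartialHomeomorph_target hf'' one_ne_zero
  have hinv : e.symm (f a) = a := e.left_inv hsrc
  have hC : ContDiffAt ℝ 1 e.symm (f a) := hf.to_localInverse hf'' one_ne_zero
  obtain ⟨u, hu, huC⟩ := hC.contDiffOn le_rfl (by simp)
  have hnhds : u ∩ e.target ∩ e.symm ⁻¹' W ∈ nhds (f a) := by
    have hu' : u ∈ nhds (f a) := by simpa using hu
    refine Filter.inter_mem (Filter.inter_mem hu' (e.open_target.mem_nhds htgt)) ?_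
    exact hC.continuousAt.preimage_mem_nhds (by rwa [hinv])
  obtain ⟨V, hVsub, hVo, hVa⟩ := mem_nhds_iff.1 hnhds
  exact ⟨V, e.symm, hVo, hVa, huC.mono fun v hv => (hVsub hv).1.1, fun v hv => (hVsub hv).2,
    hinv, fun v hv => e.right_inv (hVsub hv).1.2⟩

/-- A space with an open singleton has dimension zero. -/
theorem finrank_eq_zero_of_isOpen_subsingleton {E : Type*} [NormedAddCommGroup E]
    [NormedSpace ℝ E] [FiniteDimensional ℝ E] {U : Set E} (hU : IsOpen U) (hne : U.Nonempty)
    (hs : U.Subsingleton) : Module.finrank ℝ E = 0 := by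
  by_contra hpos
  have : Nontrivial E := Module.finrank_pos_iff.1 (Nat.pos_of_ne_zero hpos)
  obtain ⟨x, hx⟩ := hne
  have := Module.punctured_nhds_neBot ℝ E x
  refine not_isOpen_singleton x ?_
  rwa [← hs.eq_singleton_of_mem hx]

/-- An injective `C¹` map cannot lower the dimension. -/
theorem finrank_le_of_contDiffOn_injOn {E : Type*} {G : Type*} [NormedAddCommGroup E]
    [NormedSpace ℝ E] [FiniteDimensional ℝ E] [NormedAddCommGroup G] [NormedSpace ℝ G]
    [FiniteDimensional ℝ G] {F : E → G} {U : Set E} (hU : IsOpen U) (hne : U.Nonempty)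
    (hF : ContDiffOn ℝ 1 F U) (hinj : Set.InjOn F U) :
    Module.finrank ℝ E ≤ Module.finrank ℝ G := by
  induction hn : Module.finrank ℝ G generalizing E G with
  | zero =>
    have : Subsingleton G := Module.finrank_zero_iff.1 hn
    exact (finrank_eq_zero_of_isOpen_subsingleton hU hne fun x hx y hy =>
      hinj hx hy (Subsingleton.elim _ _)).le
  | succ n ih =>
    by_cases hd : ∀ y ∈ U, fderiv ℝ F y = 0
    · obtain ⟨x, hx⟩ := hne
      obtain ⟨r, hr, hball⟩ := Metric.isOpen_iff.1 hU x hx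
      refine (finrank_eq_zero_of_isOpen_subsingleton (Metric.isOpen_ball (x := x) (ε := r))
        ⟨x, Metric.mem_ball_self hr⟩ fun y hy z hz => hinj (hball hy) (hball hz) ?_).le.trans
        (Nat.zero_le _)
      exact Metric.isOpen_ball.is_const_of_fderiv_eq_zero (𝕜 := ℝ)
        (convex_ball x r).isPreconnected ((hF.differentiableOn one_ne_zero).mono hball)
        (fun w hw => hd w (hball hw)) hy hz
    push Not at hd
    obtain ⟨y, hy, hA⟩ := hd
    set A := fderiv ℝ F y with hAdef
    obtain ⟨v, hv⟩ : ∃ v, A v ≠ 0 := by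
      by_contra! h
      exact hA (ContinuousLinearMap.ext h)
    obtain ⟨l, hl⟩ := SeparatingDual.exists_eq_one (R := ℝ) hv
    set α : E →L[ℝ] ℝ := l.comp A with hα
    have hαv : α v = 1 := hl
    -- `Φ` straightens the level sets of `l ∘ F` near `y`
    set Φ : E → E := fun u => u + (l (F u) - α u) • v with hΦ
    have hΦα : ∀ u, α (Φ u) = l (F u) := fun u => by simp [hΦ, hαv]
    have hFy : ContDiffAt ℝ 1 F y := hF.contDiffAt (hU.mem_nhds hy)
    have hΦC : ContDiffAt ℝ 1 Φ y :=
      contDiffAt_id.add (((l.contDiff.contDiffAt.comp y hFy).sub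
        α.contDiff.contDiffAt).smul contDiffAt_const)
    have hΦ' : HasFDerivAt Φ (ContinuousLinearMap.id ℝ E) y := by
      have h1 : HasFDerivAt F A y := (hFy.differentiableAt one_ne_zero).hasFDerivAt
      have h2 := (hasFDerivAt_id y).add
        (((l.hasFDerivAt.comp y h1).sub α.hasFDerivAt).smul_const v)
      convert! h2 using 1
      ext w
      simp [hα]
    obtain ⟨V, Ψ, hVo, hyV, hΨC, hΨU, -, hΦΨ⟩ :=
      exists_contDiffOn_rightInverse hΦC hΦ' (hU.mem_nhds hy)
    have hl0 : (l : G →ₗ[ℝ] ℝ) ≠ 0 := fun h => by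
      have := LinearMap.congr_fun h (A v)
      simp [hl] at this
    have hα0 : (α : E →ₗ[ℝ] ℝ) ≠ 0 := fun h => by
      have := LinearMap.congr_fun h v
      simp [hαv] at this
    let P : G →L[ℝ] LinearMap.ker (l : G →ₗ[ℝ] ℝ) :=
      (ContinuousLinearMap.id ℝ G - l.smulRight (A v)).codRestrict _ fun u => by simp [hl]
    have hP : ∀ u w, l u = l w → P u = P w → u = w := fun u w huw hPuw => by
      have := congrArg Subtype.val hPuw
      simpa [P, huw] using this
    let ι : LinearMap.ker (α : E →ₗ[ℝ] ℝ) → E := fun k => Φ y + k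
    have hι : ContDiff ℝ 1 ι :=
      contDiff_const.add (LinearMap.ker (α : E →ₗ[ℝ] ℝ)).subtypeL.contDiff
    have hlev : ∀ k, ι k ∈ V → l (F (Ψ (ι k))) = α (Φ y) := fun k hk => by
      rw [← hΦα, hΦΨ _ hk]
      have : α (k : E) = 0 := k.2
      simp [ι, this]
    have hle := ih (E := LinearMap.ker (α : E →ₗ[ℝ] ℝ)) (G := LinearMap.ker (l : G →ₗ[ℝ] ℝ))
      (F := fun k => P (F (Ψ (ι k)))) (U := ι ⁻¹' V) (hVo.preimage hι.continuous)
      ⟨0, by simpa [ι] using hyV⟩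
      (P.contDiff.comp_contDiffOn ((hF.comp hΨC hΨU).comp hι.contDiffOn fun k hk => hk))
      (fun k hk k' hk' hkk' => by
        have h1 := hinj (hΨU hk) (hΨU hk')
          (hP _ _ ((hlev k hk).trans (hlev k' hk').symm) hkk')
        have h2 : ι k = ι k' := by rw [← hΦΨ _ hk, ← hΦΨ _ hk', h1]
        exact Subtype.ext (add_left_cancel h2))
      (by
        have := Module.Dual.finrank_ker_add_one_of_ne_zero hl0
        omega)
    have := Module.Dual.finrank_ker_add_one_of_ne_zero hα0
    omega

/-- Near a point where the derivative of a `C¹` map `f` is onto, every `C¹` map that is uniformly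
close to `f` attains the value of `f` at that point. -/
theorem exists_isCompact_forall_near_attains {ι : Type*} [Fintype ι] {E : Type*}
    [NormedAddCommGroup E] [NormedSpace ℝ E] [FiniteDimensional ℝ E] {f : E → ι → ℝ} {U : Set E}
    (hU : IsOpen U) (hf : ContDiffOn ℝ 1 f U) {y : E} (hy : y ∈ U)
    (hsurj : Function.Surjective (fderiv ℝ f y)) :
    ∃ K ⊆ U, IsCompact K ∧ ∃ η > 0, ∀ F : E → ι → ℝ, ContDiffOn ℝ 1 F U →
      (∀ k ∈ K, ‖F k - f k‖ ≤ η) → ∃ k ∈ K, F k = f y := by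
  obtain ⟨S, hS⟩ := (fderiv ℝ f y).exists_rightInverse_of_surjective
    (LinearMap.range_eq_top.2 hsurj)
  let a : (ι → ℝ) → E := fun u => y + S u
  have ha : ContDiff ℝ 1 a := contDiff_const.add S.contDiff
  have ha0 : a 0 = y := by simp [a]
  have hfy : ContDiffAt ℝ 1 f (a 0) := by
    rw [ha0]; exact hf.contDiffAt (hU.mem_nhds hy)
  have ha' : HasFDerivAt a S 0 := S.hasFDerivAt.const_add y
  have hfa' : HasFDerivAt (f ∘ a) (ContinuousLinearMap.id ℝ (ι → ℝ)) 0 := by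
    rw [← hS, ← ha0]
    exact (hfy.differentiableAt one_ne_zero).hasFDerivAt.comp 0 ha'
  obtain ⟨V, Ψ, hVo, hyV, hΨC, hΨU, -, hfΨ⟩ := exists_contDiffOn_rightInverse
    (hfy.comp 0 ha.contDiffAt) hfa'
    ((hU.preimage ha.continuous).mem_nhds (by simpa [ha0] using hy))
  have hz : (f ∘ a) 0 = f y := by simp [ha0]
  rw [hz] at hyV
  obtain ⟨R, hR, hball⟩ := Metric.isOpen_iff.1 hVo _ hyV
  have hsub : Metric.closedBall (f y) (2 * (R / 3)) ⊆ V :=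
    (Metric.closedBall_subset_ball (by linarith)).trans hball
  have haΨC : ContDiffOn ℝ 1 (a ∘ Ψ) V := ha.comp_contDiffOn hΨC
  have haΨU : Set.MapsTo (a ∘ Ψ) V U := fun w hw => hΨU hw
  refine ⟨a ∘ Ψ '' Metric.closedBall (f y) (2 * (R / 3)), ?_,
    (isCompact_closedBall _ _).image_of_continuousOn (haΨC.continuousOn.mono hsub), R / 3,
    by positivity, fun F hF hFf => ?_⟩
  · rintro _ ⟨w, hw, rfl⟩
    exact haΨU (hsub hw)
  obtain ⟨x, hx, hFx⟩ := exists_eq_center_of_near_id (g := F ∘ a ∘ Ψ) (z := f y) (r := R / 3)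
    (by positivity)
    ((hF.comp haΨC haΨU).mono (by rwa [mul_div_cancel₀ R three_ne_zero]))
    (fun x hx => by
      have h1 := hFf _ ⟨x, hx, rfl⟩
      have h2 : f ((a ∘ Ψ) x) = x := hfΨ x (hsub hx)
      rwa [h2] at h1)
  exact ⟨_, ⟨x, Metric.closedBall_subset_closedBall (by linarith) hx, rfl⟩, hFx⟩

/-- The easy case of Sard's theorem: the critical values of a differentiable map whose source has
dimension at most that of its target form a null set. -/
theorem volume_image_setOf_not_surjective_fderiv_eq_zero {ι : Type*} [Fintype ι] {E : Type*}
    [NormedAddCommGroup E] [NormedSpace ℝ E] [FiniteDimensional ℝ E]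
    (hdim : Module.finrank ℝ E ≤ Fintype.card ι) {f : E → ι → ℝ} {U : Set E}
    (hf : ∀ x ∈ U, DifferentiableAt ℝ f x) :
    volume (f '' {x ∈ U | ¬ Function.Surjective (fderiv ℝ f x)}) = 0 := by
  obtain ⟨i, hi⟩ := finrank_le_iff_exists_linearMap (R := ℝ) (M := E) (M' := ι → ℝ) |>.1
    (by simpa using hdim)
  obtain ⟨p', hp'⟩ := i.exists_leftInverse_of_injective (LinearMap.ker_eq_bot.2 hi)
  let p : (ι → ℝ) →L[ℝ] E := p'.toContinuousLinearMap
  have hp : Function.Surjective p := fun x => ⟨i x, LinearMap.congr_fun hp' x⟩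
  have himg : f '' {x ∈ U | ¬ Function.Surjective (fderiv ℝ f x)}
      = (f ∘ p) '' (p ⁻¹' {x ∈ U | ¬ Function.Surjective (fderiv ℝ f x)}) := by
    rw [Set.image_comp, Set.image_preimage_eq _ hp]
  rw [himg]
  refine addHaar_image_eq_zero_of_det_fderivWithin_eq_zero volume
    (f' := fun x => (fderiv ℝ f (p x)).comp p)
    (fun x hx => ((hf _ hx.1).hasFDerivAt.comp x p.hasFDerivAt).hasFDerivWithinAt)
    fun x hx => ?_
  by_contra hdet
  refine hx.2 ?_
  have hs : Function.Surjective ((fderiv ℝ f (p x)).comp p) :=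
    (LinearMap.equivOfDetNeZero _ hdet).surjective
  exact Function.Surjective.of_comp hs

/-- A `C¹` map on a manifold is `C¹` when read in a preferred chart. -/
theorem ContMDiff.contDiffOn_comp_chartAt_symm {m : ℕ} {M : Type*} [TopologicalSpace M]
    [ChartedSpace (EuclideanSpace ℝ (Fin m)) M] [HasGroupoid M (contDiffGroupoid 1 (𝓡 m))]
    {V : Type*} [NormedAddCommGroup V] [NormedSpace ℝ V] {f : M → V}
    (hf : ContMDiff (𝓡 m) 𝓘(ℝ, V) 1 f) (c : M) :
    ContDiffOn ℝ 1 (f ∘ (chartAt (EuclideanSpace ℝ (Fin m)) c).symm)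
      (chartAt (EuclideanSpace ℝ (Fin m)) c).target := by
  have : IsManifold (𝓡 m) 1 M := { }
  have h := hf.comp_contMDiffOn (contMDiffOn_extChartAt_symm (I := 𝓡 m) (n := 1) c)
  simpa [contMDiffOn_iff_contDiffOn, extChartAt, Function.comp_def] using h

section CountableUnion

variable {ι : Type*} [Fintype ι] {J : Type*} {dj : J → ℕ} {Θ : J → Type*}
  [∀ j, TopologicalSpace (Θ j)] [∀ j, ChartedSpace (EuclideanSpace ℝ (Fin (dj j))) (Θ j)]
  [∀ j, HasGroupoid (Θ j) (contDiffGroupoid 1 (𝓡 (dj j)))]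

/-- Near a regular point of `f`, every `C¹` map uniformly close to `f` attains the value of `f`
at that point. -/
theorem exists_isCompact_sigma_forall_near_attains {f : (Σ j, Θ j) → ι → ℝ}
    (hf : ∀ j, ContMDiff (𝓡 (dj j)) 𝓘(ℝ, ι → ℝ) 1 (fun x : Θ j => f ⟨j, x⟩)) {j : J} {c x : Θ j}
    (hx : x ∈ (chartAt (EuclideanSpace ℝ (Fin (dj j))) c).source)
    (hreg : Function.Surjective (fderiv ℝ
      (fun y => f ⟨j, (chartAt (EuclideanSpace ℝ (Fin (dj j))) c).symm y⟩)
      (chartAt (EuclideanSpace ℝ (Fin (dj j))) c x)))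
    {W : Set (Σ j, Θ j)} (hW : IsOpen W) (hxW : ⟨j, x⟩ ∈ W) :
    ∃ K ⊆ W, IsCompact K ∧ ∃ η > 0, ∀ F : (Σ j, Θ j) → ι → ℝ,
      (∀ j, ContMDiff (𝓡 (dj j)) 𝓘(ℝ, ι → ℝ) 1 (fun x : Θ j => F ⟨j, x⟩)) →
      (∀ k ∈ K, ‖F k - f k‖ ≤ η) → ∃ k ∈ K, F k = f ⟨j, x⟩ := by
  set e := chartAt (EuclideanSpace ℝ (Fin (dj j))) c with he
  let ψ : EuclideanSpace ℝ (Fin (dj j)) → Σ j, Θ j := fun y => ⟨j, e.symm y⟩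
  have hψ : ContinuousOn ψ e.target := continuous_sigmaMk.comp_continuousOn e.continuousOn_symm
  have hψx : ψ (e x) = ⟨j, x⟩ := by simp [ψ, e.left_inv hx]
  obtain ⟨K, hKU, hK, η, hη, hF⟩ := exists_isCompact_forall_near_attains
    (hψ.isOpen_inter_preimage e.open_target hW)
    (((hf j).contDiffOn_comp_chartAt_symm c).mono Set.inter_subset_left)
    (y := e x) ⟨e.map_source hx, by rwa [Set.mem_preimage, hψx]⟩ hreg
  refine ⟨ψ '' K, ?_, hK.image_of_continuousOn (hψ.mono (hKU.trans Set.inter_subset_left)),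
    η, hη, fun F hFC hFf => ?_⟩
  · rintro _ ⟨y, hy, rfl⟩
    exact (hKU hy).2
  · obtain ⟨k, hk, hFk⟩ := hF (F ∘ ψ)
      (((hFC j).contDiffOn_comp_chartAt_symm c).mono Set.inter_subset_left)
      (fun k hk => hFf _ ⟨k, hk, rfl⟩)
    refine ⟨ψ k, ⟨k, hk, rfl⟩, ?_⟩
    rw [← hψx]
    exact hFk

/-- If a `C¹` map on a countable disjoint union of `C¹` manifolds can be approximated, uniformly
on compact sets, by injective `C¹` maps, then almost every value has at most one preimage. -/
theorem volume_setOf_multiple_preimages_eq_zero [Countable J] [∀ j, T2Space (Θ j)]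
    [∀ j, SecondCountableTopology (Θ j)] {f : (Σ j, Θ j) → ι → ℝ}
    (hf : ∀ j, ContMDiff (𝓡 (dj j)) 𝓘(ℝ, ι → ℝ) 1 (fun x : Θ j => f ⟨j, x⟩))
    (happrox : ∀ K : Set (Σ j, Θ j), IsCompact K → ∀ η > 0, ∃ F : (Σ j, Θ j) → ι → ℝ,
      Function.Injective F ∧
      (∀ j, ContMDiff (𝓡 (dj j)) 𝓘(ℝ, ι → ℝ) 1 (fun x : Θ j => F ⟨j, x⟩)) ∧
      ∀ k ∈ K, ‖F k - f k‖ ≤ η) :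
    volume {z | ∃ p q : Σ j, Θ j, p ≠ q ∧ f p = z ∧ f q = z} = 0 := by
  choose s hsc hs using fun j => TopologicalSpace.countable_cover_nhds
    (fun c : Θ j => (chartAt (EuclideanSpace ℝ (Fin (dj j))) c).open_source.mem_nhds
      (mem_chart_source _ c))
  let g : ∀ j, Θ j → EuclideanSpace ℝ (Fin (dj j)) → ι → ℝ := fun j c y =>
    f ⟨j, (chartAt (EuclideanSpace ℝ (Fin (dj j))) c).symm y⟩
  let crit : ∀ j, Θ j → Set (ι → ℝ) := fun j c => g j c ''
    {y ∈ (chartAt (EuclideanSpace ℝ (Fin (dj j))) c).target |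
      ¬ Function.Surjective (fderiv ℝ (g j c) y)}
  have hcrit : ∀ j c, volume (crit j c) = 0 := by
    intro j c
    set e := chartAt (EuclideanSpace ℝ (Fin (dj j))) c with he
    refine volume_image_setOf_not_surjective_fderiv_eq_zero ?_ fun y hy =>
      (((hf j).contDiffOn_comp_chartAt_symm c).contDiffAt
        (e.open_target.mem_nhds hy)).differentiableAt one_ne_zero
    obtain ⟨F, hFinj, hFC, -⟩ := happrox ∅ isCompact_empty 1 one_pos
    have := finrank_le_of_contDiffOn_injOn e.open_target
      ⟨e c, e.map_source (mem_chart_source _ c)⟩ ((hFC j).contDiffOn_comp_chartAt_symm c)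
      (fun y hy y' hy' h => e.symm.injOn hy hy' (sigma_mk_injective (hFinj h)))
    simpa using this
  have hnull : volume (⋃ j, ⋃ c ∈ s j, crit j c) = 0 :=
    measure_iUnion_null fun j => (measure_biUnion_null_iff (hsc j)).2 fun c _ => hcrit j c
  refine measure_mono_null ?_ hnull
  rintro z ⟨⟨j₁, x₁⟩, ⟨j₂, x₂⟩, hne, rfl, hq⟩
  by_contra hz
  have hreg : ∀ j x, f ⟨j, x⟩ = f ⟨j₁, x₁⟩ →
      ∃ c, x ∈ (chartAt (EuclideanSpace ℝ (Fin (dj j))) c).source ∧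
        Function.Surjective
          (fderiv ℝ (g j c) (chartAt (EuclideanSpace ℝ (Fin (dj j))) c x)) := by
    intro j x hfx
    have hxs : x ∈ ⋃ c ∈ s j, (chartAt (EuclideanSpace ℝ (Fin (dj j))) c).source := by
      rw [hs j]; trivial
    obtain ⟨c, hc, hxc⟩ := Set.mem_iUnion₂.1 hxs
    refine ⟨c, hxc, ?_⟩
    by_contra hns
    refine hz (Set.mem_iUnion.2 ⟨j, Set.mem_iUnion₂.2 ⟨c, hc, _,
      ⟨OpenPartialHomeomorph.map_source _ hxc, hns⟩, ?_⟩⟩)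
    simp only [g]
    rw [OpenPartialHomeomorph.left_inv _ hxc, hfx]
  obtain ⟨W₁, W₂, hW₁, hW₂, hx₁, hx₂, hdisj⟩ := t2_separation hne
  obtain ⟨c₁, hc₁, hr₁⟩ := hreg j₁ x₁ rfl
  obtain ⟨c₂, hc₂, hr₂⟩ := hreg j₂ x₂ hq
  obtain ⟨K₁, hKW₁, hK₁, η₁, hη₁, h₁⟩ :=
    exists_isCompact_sigma_forall_near_attains hf hc₁ hr₁ hW₁ hx₁
  obtain ⟨K₂, hKW₂, hK₂, η₂, hη₂, h₂⟩ :=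
    exists_isCompact_sigma_forall_near_attains hf hc₂ hr₂ hW₂ hx₂
  obtain ⟨F, hFinj, hFC, hF⟩ := happrox (K₁ ∪ K₂) (hK₁.union hK₂) (min η₁ η₂) (lt_min hη₁ hη₂)
  obtain ⟨k₁, hk₁, hFk₁⟩ := h₁ F hFC fun k hk => (hF k (Or.inl hk)).trans (min_le_left _ _)
  obtain ⟨k₂, hk₂, hFk₂⟩ := h₂ F hFC fun k hk => (hF k (Or.inr hk)).trans (min_le_right _ _)
  have hk : k₁ = k₂ := hFinj (by rw [hFk₁, hFk₂, hq])
  exact Set.disjoint_left.1 hdisj (hKW₁ hk₁) (hk ▸ hKW₂ hk₂)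

end CountableUnion

/-- Difference quotients in a parameter converge to the directional derivative uniformly on
compact sets, even when the parameter is only allowed to take values in a dense set. -/
theorem exists_diffQuotient_near_fderiv {V W X : Type*} [NormedAddCommGroup V] [NormedSpace ℝ V]
    [NormedAddCommGroup W] [NormedSpace ℝ W] [TopologicalSpace X] {h : V → X → W} {B : Set V}
    (hB : IsOpen B) {β₀ : V} (hβ₀ : β₀ ∈ B) (hdiff : ∀ x, DifferentiableOn ℝ (fun β => h β x) B)
    (hcont : ContinuousOn (fun p : V × X => fderiv ℝ (fun β => h β p.2) p.1) (B ×ˢ Set.univ))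
    {D : Set V} (hD : Dense D) (v : V) {K : Set X} (hK : IsCompact K) {η : ℝ} (hη : 0 < η) :
    ∃ β ∈ B ∩ D, ∃ t : ℝ, 0 < t ∧
      ∀ x ∈ K, ‖t⁻¹ • (h β x - h β₀ x) - fderiv ℝ (fun β => h β x) β₀ v‖ ≤ η := by
  have hcont0 : Continuous fun x => fderiv ℝ (fun β => h β x) β₀ :=
    hcont.comp_continuous (by fun_prop : Continuous fun x : X => (β₀, x)) fun x => ⟨hβ₀, trivial⟩
  obtain ⟨M, hM⟩ := hK.exists_bound_of_continuousOn hcont0.continuousOn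
  set ε : ℝ := η / (2 * (‖v‖ + 1)) with hεdef
  have hε : 0 < ε := by positivity
  have hnear : ∀ᶠ β in nhds β₀, ∀ x ∈ K,
      ‖fderiv ℝ (fun β => h β x) β - fderiv ℝ (fun β => h β x) β₀‖ < ε := by
    refine hK.eventually_forall_of_forall_eventually fun x _ => ?_
    have h1 : ContinuousAt (fun p : V × X => fderiv ℝ (fun β => h β p.2) p.1
        - fderiv ℝ (fun β => h β p.2) β₀) (β₀, x) :=
      (hcont.continuousAt ((hB.prod isOpen_univ).mem_nhds ⟨hβ₀, trivial⟩)).sub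
        (hcont0.comp continuous_snd).continuousAt
    exact h1.norm.eventually_lt_const (by simpa using hε)
  obtain ⟨δ, hδ, hball⟩ := Metric.eventually_nhds_iff_ball.1 (hnear.and (hB.mem_nhds hβ₀))
  have hmvt : ∀ β ∈ Metric.ball β₀ δ, ∀ x ∈ K,
      ‖h β x - h β₀ x - fderiv ℝ (fun β => h β x) β₀ (β - β₀)‖ ≤ ε * ‖β - β₀‖ := by
    intro β hβ x hx
    refine (convex_ball β₀ δ).norm_image_sub_le_of_norm_hasFDerivWithin_le'
      (f := fun β => h β x) (f' := fun β => fderiv ℝ (fun β => h β x) β)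
      (fun w hw => ?_) (fun w hw => ((hball w hw).1 x hx).le) (Metric.mem_ball_self hδ) hβ
    exact ((hdiff x).differentiableAt (hB.mem_nhds (hball w hw).2)).hasFDerivAt.hasFDerivWithinAt
  set ρ : ℝ := min 1 (η / (2 * (|M| + 1))) with hρdef
  have hρ : 0 < ρ := by positivity
  have hρ1 : ρ ≤ 1 := min_le_left _ _
  have hρM : |M| * ρ ≤ η / 2 := by
    have h1 : ρ * (2 * (|M| + 1)) ≤ η :=
      (le_div_iff₀ (by positivity)).1 (min_le_right _ _)
    nlinarith [abs_nonneg M]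
  set t : ℝ := δ / (2 * (‖v‖ + 1)) with htdef
  have ht : 0 < t := by positivity
  have htδ : t * (‖v‖ + 1) < δ := by
    rw [htdef, div_mul_eq_mul_div, div_lt_iff₀ (by positivity)]
    nlinarith [norm_nonneg v, mul_pos hδ (by positivity : 0 < ‖v‖ + 1)]
  obtain ⟨β, hβt, hβD⟩ := hD.inter_open_nonempty (Metric.ball (β₀ + t • v) (t * ρ))
    Metric.isOpen_ball ⟨_, Metric.mem_ball_self (by positivity)⟩
  have hdist : ‖β - β₀ - t • v‖ ≤ t * ρ := by
    rw [sub_sub]; exact (mem_ball_iff_norm.1 hβt).le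
  have hββ₀ : ‖β - β₀‖ ≤ t * (‖v‖ + 1) := by
    calc ‖β - β₀‖ = ‖(β - β₀ - t • v) + t • v‖ := by rw [sub_add_cancel]
      _ ≤ t * ρ + t * ‖v‖ := (norm_add_le _ _).trans (by
        rw [norm_smul, Real.norm_of_nonneg ht.le]; gcongr)
      _ ≤ t * (‖v‖ + 1) := by nlinarith
  have hβδ : β ∈ Metric.ball β₀ δ := mem_ball_iff_norm.2 (hββ₀.trans_lt htδ)
  refine ⟨β, ⟨(hball β hβδ).2, hβD⟩, t, ht, fun x hx => ?_⟩
  set A := fderiv ℝ (fun β => h β x) β₀ with hA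
  have hsplit : t⁻¹ • (h β x - h β₀ x) - A v
      = t⁻¹ • ((h β x - h β₀ x - A (β - β₀)) + A (β - β₀ - t • v)) := by
    rw [map_sub A (β - β₀), map_smul, sub_add_sub_cancel, smul_sub t⁻¹ _ (t • A v),
      inv_smul_smul₀ ht.ne']
  rw [hsplit, norm_smul, norm_inv, Real.norm_of_nonneg ht.le, inv_mul_le_iff₀ ht]
  have h1 : ‖h β x - h β₀ x - A (β - β₀)‖ ≤ t * (η / 2) := by
    refine (hmvt β hβδ x hx).trans ((mul_le_mul_of_nonneg_left hββ₀ hε.le).trans_eq ?_)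
    rw [hεdef]
    field_simp
  have h2 : ‖A (β - β₀ - t • v)‖ ≤ t * (η / 2) := by
    refine (A.le_of_opNorm_le_of_le ((hM x hx).trans (le_abs_self M)) hdist).trans ?_
    nlinarith
  linarith [norm_add_le (h β x - h β₀ x - A (β - β₀)) (A (β - β₀ - t • v))]

/-- measure-zero non-invertibility step in the proof of Theorem 4:
under twice continuous differentiability in `β`, joint continuity, C¹ dependence on `π`
on each component of `Π`, the weak-identification drift condition along `β_n → β₀`, and
almost-everywhere injectivity of `π ↦ h(β,π) − h(β₀,π)`, for every `z₁` the set of `z₂`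
for which `h_β(β₀,π)(z₁ − b) = z₂ − h_β(β₀,π₀)b` has more than one solution `π` has
Lebesgue measure zero. -/
theorem weakId_noninvertible_null (dβ dh : ℕ)
    {J : Type*} [Countable J] (dj : J → ℕ)
    (Θ : J → Type*) [∀ j, TopologicalSpace (Θ j)] [∀ j, T2Space (Θ j)]
    [∀ j, SecondCountableTopology (Θ j)]
    [∀ j, ChartedSpace (EuclideanSpace ℝ (Fin (dj j))) (Θ j)]
    [∀ j, HasGroupoid (Θ j) (contDiffGroupoid 1 (𝓡 (dj j)))]
    (B : Set (Fin dβ → ℝ)) (hB : IsOpen B) (β₀ : Fin dβ → ℝ) (hβ₀ : β₀ ∈ B)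
    (h : (Fin dβ → ℝ) → (Σ j, Θ j) → (Fin dh → ℝ))
    (hh2 : ∀ π : Σ j, Θ j, ContDiffOn ℝ 2 (fun β => h β π) B)
    (hhcont : ContinuousOn (fun p : (Fin dβ → ℝ) × (Σ j, Θ j) => h p.1 p.2)
      (B ×ˢ (Set.univ : Set (Σ j, Θ j))))
    (hhβcont : ContinuousOn
      (fun p : (Fin dβ → ℝ) × (Σ j, Θ j) => fderiv ℝ (fun β => h β p.2) p.1)
      (B ×ˢ (Set.univ : Set (Σ j, Θ j))))
    (hπC1 : ∀ β ∈ B, ∀ j, ContMDiff (𝓡 (dj j)) 𝓘(ℝ, Fin dh → ℝ) 1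
      (fun x : Θ j => h β ⟨j, x⟩))
    (hβπC1 : ∀ j, ContMDiff (𝓡 (dj j)) 𝓘(ℝ, (Fin dβ → ℝ) →L[ℝ] (Fin dh → ℝ)) 1
      (fun x : Θ j => fderiv ℝ (fun β => h β ⟨j, x⟩) β₀))
    (π₀ : Σ j, Θ j) (b : Fin dβ → ℝ)
    (βseq : ℕ → (Fin dβ → ℝ)) (hβseqB : ∀ n, βseq n ∈ B)
    (hβseqlim : Filter.Tendsto βseq Filter.atTop (nhds β₀))
    (hweak : ∀ K : Set (Σ j, Θ j), IsCompact K →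
      TendstoUniformlyOn
        (fun (n : ℕ) π => Real.sqrt n • (h (βseq n) π - h β₀ π))
        (fun π => fderiv ℝ (fun β => h β π) β₀ b) Filter.atTop K)
    (hinj : ∀ᵐ β ∂(volume.restrict B),
      Function.Injective (fun π : Σ j, Θ j => h β π - h β₀ π)) :
    ∀ z₁ : Fin dβ → ℝ,
      volume {z₂ : Fin dh → ℝ | ∃ π₁ π₂ : Σ j, Θ j, π₁ ≠ π₂ ∧
        fderiv ℝ (fun β => h β π₁) β₀ (z₁ - b) =
          z₂ - fderiv ℝ (fun β => h β π₀) β₀ b ∧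
        fderiv ℝ (fun β => h β π₂) β₀ (z₁ - b) =
          z₂ - fderiv ℝ (fun β => h β π₀) β₀ b} = 0 := by
  intro z₁
  have hD : Dense {β | β ∈ B → Function.Injective (fun π : Σ j, Θ j => h β π - h β₀ π)} :=
    Measure.dense_of_ae ((ae_restrict_iff' hB.measurableSet).1 hinj)
  have hnull := volume_setOf_multiple_preimages_eq_zero
    (f := fun π : Σ j, Θ j => fderiv ℝ (fun β => h β π) β₀ (z₁ - b))
    (fun j => (ContinuousLinearMap.apply ℝ (Fin dh → ℝ) (z₁ - b)).contMDiff.comp (hβπC1 j))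
    (fun K hK η hη => by
      obtain ⟨β, ⟨hβB, hβD⟩, t, ht, hβ⟩ := exists_diffQuotient_near_fderiv hB hβ₀
        (fun π => (hh2 π).differentiableOn two_ne_zero) hhβcont hD (z₁ - b) hK hη
      refine ⟨fun π => t⁻¹ • (h β π - h β₀ π), fun π π' hππ' => hβD hβB ?_, fun j => ?_, hβ⟩
      · exact smul_right_injective _ (inv_ne_zero ht.ne') hππ'
      · exact (contDiff_const_smul t⁻¹).contMDiff.comp ((hπC1 β hβB j).sub (hπC1 β₀ hβ₀ j)))
  rw [← measure_preimage_add_right volume (-fderiv ℝ (fun β => h β π₀) β₀ b)] at hnull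
  simpa only [Set.preimage_ofPred_eq, ← sub_eq_add_neg] using hnull
end

section
/- Let B ⊆ ℝ^{d_β} be open with β₀ ∈ B, and let Π be the disjoint union of a finite or countable family of second-countable Hausdorff C¹ manifolds (without boundary). Let h : B × Π → ℝ^{d_h} satisfy: β ↦ h(β,π) is twice continuously differentiable for each π, with derivative in β denoted h_β(β,π); the maps (β,π) ↦ h(β,π) and (β,π) ↦ h_β(β,π) are continuous; and for each β ∈ B the maps π ↦ h(β,π) and π ↦ h_β(β₀,π) are continuously differentiable on each component of Π. Let π₀ ∈ Π, b ∈ ℝ^{d_β}, and let (β_n) be a sequence in B with β_n → β₀ and √n·(h(β_n,π) − h(β₀,π)) → h_β(β₀,π)b uniformly on compact subsets of Π. Assume: (c) for all distinct π₁, π₂ ∈ Π, the d_h × d_β matrix h_β(β₀,π₁) − h_β(β₀,π₂) has rank d_h; and (d) for Lebesgue-almost every β ∈ B, the map π ↦ h(β,π) − h(β₀,π) is injective on Π. Let d_z = d_β + d_h, let H be a symmetric positive definite d_z × d_z matrix, let κ : Π → ℝ be continuous, define Q(π,z) as in the weak-identification limit objective setup with A(π) = h_β(β₀,π), and let z be a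 random vector in ℝ^{d_z} whose distribution is absolutely continuous with respect to Lebesgue measure. Then, almost surely, the function π ↦ Q(π,z) has at most one global minimizer over Π. -/
open MeasureTheory Matrix
open scoped Manifold

/-- The matrix of a continuous linear map `ℝ^{d_β} → ℝ^{d_h}` in the standard bases. -/
noncomputable def clmMatrix (dβ dh : ℕ) (L : (Fin dβ → ℝ) →L[ℝ] (Fin dh → ℝ)) :
    Matrix (Fin dh) (Fin dβ) ℝ :=
  Matrix.of fun i j => L (Pi.single j 1) i

/-- The matrix `S(π) = H^{1/2}·(I_{d_β}; A(π))`. -/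
noncomputable def weakIdS (dβ dh : ℕ)
    (Hhalf : Matrix (Fin (dβ + dh)) (Fin (dβ + dh)) ℝ)
    (A : Matrix (Fin dh) (Fin dβ) ℝ) : Matrix (Fin (dβ + dh)) (Fin dβ) ℝ :=
  Hhalf * Matrix.of (fun i j =>
    Fin.append (fun i' => (1 : Matrix (Fin dβ) (Fin dβ) ℝ) i' j) (fun i' => A i' j) i)

/-- The vector `g(π) = H^{1/2}·(0_{d_β}; A(π)b − A(π₀)b)`. -/
noncomputable def weakIdg (dβ dh : ℕ)
    (Hhalf : Matrix (Fin (dβ + dh)) (Fin (dβ + dh)) ℝ)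
    (A A₀ : Matrix (Fin dh) (Fin dβ) ℝ) (b : Fin dβ → ℝ) : Fin (dβ + dh) → ℝ :=
  Hhalf.mulVec (Fin.append (0 : Fin dβ → ℝ) (A.mulVec b - A₀.mulVec b))

/-- The weak-identification limit objective
`Q(π,z) = 2zᵀ(H^{1/2})ᵀg(π) − (H^{1/2}z + g(π))ᵀP(π)(H^{1/2}z + g(π)) + κ(π)`, where
`P(π) = S(π)(S(π)ᵀS(π))⁻¹S(π)ᵀ`. -/
noncomputable def weakIdQ (dβ dh : ℕ)
    (Hhalf : Matrix (Fin (dβ + dh)) (Fin (dβ + dh)) ℝ)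
    {Θ : Type*} (A : Θ → Matrix (Fin dh) (Fin dβ) ℝ) (π₀ : Θ) (b : Fin dβ → ℝ)
    (κ : Θ → ℝ) (π : Θ) (z : Fin (dβ + dh) → ℝ) : ℝ :=
  let g := weakIdg dβ dh Hhalf (A π) (A π₀) b
  let S := weakIdS dβ dh Hhalf (A π)
  let P : Matrix (Fin (dβ + dh)) (Fin (dβ + dh)) ℝ := S * (Sᵀ * S)⁻¹ * Sᵀ
  2 * (Hhalf.mulVec z ⬝ᵥ g) - ((Hhalf.mulVec z + g) ⬝ᵥ P.mulVec (Hhalf.mulVec z + g)) + κ π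

theorem integral_eval_eq_of_forall_mem_Icc {α : Type*} [MeasurableSpace α] {μ : Measure α}
    (p : α → Polynomial ℝ) (N : ℕ) (hp : ∀ x, (p x).natDegree ≤ N) {s₀ c : ℝ} (hs₀ : 0 < s₀)
    (hintegrable : ∀ s ∈ Set.Icc 0 s₀, Integrable (fun x => (p x).eval s) μ)
    (hc : ∀ s ∈ Set.Icc 0 s₀, ∫ x, (p x).eval s ∂μ = c) (t : ℝ) :
    ∫ x, (p x).eval t ∂μ = c := by
  classical
  set v : ℕ → ℝ := fun i => s₀ / (i + 1) with hv
  have hvmem : ∀ i, v i ∈ Set.Icc 0 s₀ := fun i =>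
    ⟨by positivity, div_le_self hs₀.le (by linarith [(Nat.cast_nonneg i : (0 : ℝ) ≤ i)])⟩
  have hinj : Set.InjOn v (Finset.range (N + 1) : Finset ℕ) := by
    intro i _ j _ hij
    have hi : ((i : ℝ) + 1) ≠ 0 := by positivity
    have hj : ((j : ℝ) + 1) ≠ 0 := by positivity
    simp only [hv] at hij
    rw [div_eq_div_iff hi hj] at hij
    have := mul_left_cancel₀ hs₀.ne' hij
    exact_mod_cast (add_right_cancel this).symm
  have heval : ∀ x, (p x).eval t = ∑ i ∈ Finset.range (N + 1),
      (p x).eval (v i) * (Lagrange.basis (Finset.range (N + 1)) v i).eval t := by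
    intro x
    have hdeg : (p x).degree < ((Finset.range (N + 1)).card : WithBot ℕ) := by
      rw [Finset.card_range]
      exact lt_of_le_of_lt (Polynomial.degree_le_of_natDegree_le (hp x))
        (by exact_mod_cast Nat.lt_succ_self N)
    conv_lhs => rw [Lagrange.eq_interpolate hinj hdeg, Lagrange.interpolate_apply]
    simp [Polynomial.eval_finsetSum]
  simp_rw [heval]
  rw [integral_finsetSum _ fun i _ => (hintegrable _ (hvmem i)).mul_const _]
  simp_rw [integral_mul_const, hc _ (hvmem _), ← Finset.mul_sum]
  rw [← Polynomial.eval_finsetSum, Lagrange.sum_basis hinj (by simp)]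
  simp

theorem exists_polynomial_eval_eq_det_one_add_smul {E : Type*} [NormedAddCommGroup E]
    [NormedSpace ℝ E] [FiniteDimensional ℝ E] (M : E →L[ℝ] E) :
    ∃ p : Polynomial ℝ, p.natDegree ≤ Module.finrank ℝ E ∧
      ∀ s, p.eval s = (ContinuousLinearMap.id ℝ E + s • M).det := by
  let b := Module.finBasis ℝ E
  let A := LinearMap.toMatrix b b (M : E →ₗ[ℝ] E)
  refine ⟨((Polynomial.X : Polynomial ℝ) • A.map Polynomial.C +
    (1 : Matrix (Fin (Module.finrank ℝ E)) (Fin (Module.finrank ℝ E)) ℝ).map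
      Polynomial.C).det, ?_, ?_⟩
  · simpa using Polynomial.natDegree_det_X_add_C_le A 1
  · intro s
    rw [ContinuousLinearMap.det, ← LinearMap.det_toMatrix b, ← Polynomial.coe_evalRingHom,
      RingHom.map_det]
    congr 1
    ext i j
    simp [A, Matrix.one_apply, LinearMap.toMatrix_apply, add_comm, Finsupp.single_apply,
      eq_comm, apply_ite]
    exact mul_comm _ _

section Covering

variable {E : Type*} [NormedAddCommGroup E] [InnerProductSpace ℝ E] [FiniteDimensional ℝ E]

theorem exists_forall_integral_det_mul_comp_eq [MeasurableSpace E] [BorelSpace E] {u : E → E}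
    (hu : ContDiff ℝ 1 u) {R : ℝ} (hR : ∀ x ∉ Metric.ball (0 : E) R, u x = 0) :
    ∃ s₀ > 0, ∀ s ∈ Set.Icc (0 : ℝ) s₀, ∀ g : E → ℝ,
      ∫ x in Metric.ball 0 R,
        (ContinuousLinearMap.id ℝ E + s • fderiv ℝ u x).det * g (x + s • u x) =
      ∫ x in Metric.ball 0 R, g x := by
  have hsupp : HasCompactSupport u :=
    HasCompactSupport.intro (isCompact_closedBall (0 : E) R) fun x hx =>
      hR x fun h => hx (Metric.ball_subset_closedBall h)
  obtain ⟨C, hC⟩ := hu.lipschitzWith_of_hasCompactSupport hsupp one_ne_zero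
  have hdet : ∀ᶠ M in nhds (ContinuousLinearMap.id ℝ E), 0 < M.det := by
    have := (ContinuousLinearMap.continuous_det (𝕜 := ℝ) (E := E)).tendsto
      (ContinuousLinearMap.id ℝ E)
    refine this.eventually (lt_mem_nhds ?_)
    simp [ContinuousLinearMap.det]
  obtain ⟨δ, hδ, hδdet⟩ := Metric.eventually_nhds_iff.1 hdet
  have hs₀ : (0 : ℝ) < min 1 δ / 2 / (C + 1) := by positivity
  refine ⟨_, hs₀, fun s hs g => ?_⟩
  have hsC : s * C < min 1 δ := by
    have h1 : s * (C + 1) ≤ min 1 δ / 2 := by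
      rw [← le_div_iff₀ (by positivity)]; exact hs.2
    have h2 : 0 < min 1 δ := by positivity
    nlinarith [hs.1]
  have hfd : ∀ x, HasFDerivAt (fun x => x + s • u x)
      (ContinuousLinearMap.id ℝ E + s • fderiv ℝ u x) x := fun x =>
    (hasFDerivAt_id x).add
      (((hu.differentiable one_ne_zero) x).hasFDerivAt.const_smul s)
  have hpos : ∀ x, 0 < (ContinuousLinearMap.id ℝ E + s • fderiv ℝ u x).det := by
    intro x
    apply hδdet
    rw [dist_eq_norm, add_sub_cancel_left, norm_smul, Real.norm_of_nonneg hs.1]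
    calc s * ‖fderiv ℝ u x‖ ≤ s * C :=
          mul_le_mul_of_nonneg_left (norm_fderiv_le_of_lipschitz ℝ hC) hs.1
      _ < δ := hsC.trans_le (min_le_right _ _)
  have happ : ApproximatesLinearOn (fun x => x + s • u x)
      ((ContinuousLinearEquiv.refl ℝ E : E ≃L[ℝ] E) : E →L[ℝ] E) Set.univ
      (⟨s, hs.1⟩ * C : NNReal) := by
    intro x _ y _
    have : (x + s • u x - (y + s • u y) -
        ((ContinuousLinearEquiv.refl ℝ E : E ≃L[ℝ] E) : E →L[ℝ] E) (x - y)) =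
        s • (u x - u y) := by simp [smul_sub]; abel
    rw [this, norm_smul, Real.norm_of_nonneg hs.1]
    change s * ‖u x - u y‖ ≤ s * C * ‖x - y‖
    rw [mul_assoc]
    exact mul_le_mul_of_nonneg_left (hC.norm_sub_le x y) hs.1
  have hsmall : Subsingleton E ∨ (⟨s, hs.1⟩ * C : NNReal) <
      ‖((ContinuousLinearEquiv.refl ℝ E : E ≃L[ℝ] E).symm : E →L[ℝ] E)‖₊⁻¹ := by
    rcases subsingleton_or_nontrivial E with hE | hE
    · exact Or.inl hE
    · right
      have : ‖((ContinuousLinearEquiv.refl ℝ E : E ≃L[ℝ] E).symm : E →L[ℝ] E)‖₊ = 1 := by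
        have : ((ContinuousLinearEquiv.refl ℝ E : E ≃L[ℝ] E).symm : E →L[ℝ] E) =
          ContinuousLinearMap.id ℝ E := rfl
        rw [this]
        exact NNReal.eq (by simp)
      rw [this, inv_one, ← NNReal.coe_lt_coe]
      exact hsC.trans_le (min_le_left _ _)
  have hinj : Function.Injective (fun x => x + s • u x) :=
    (Set.injOn_univ).1 (happ.injOn hsmall)
  have hsurj : Function.Surjective (fun x => x + s • u x) := happ.surjective hsmall
  have himage : (fun x => x + s • u x) '' Metric.ball 0 R = Metric.ball 0 R := by
    have hfix : ∀ x ∉ Metric.ball (0 : E) R, x + s • u x = x := fun x hx => by simp [hR x hx]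
    ext y
    constructor
    · rintro ⟨x, hx, rfl⟩
      by_contra hy
      have := hinj (hfix _ hy)
      exact hy (by rwa [this])
    · intro hy
      obtain ⟨x, rfl⟩ := hsurj y
      refine ⟨x, ?_, rfl⟩
      by_contra hx
      simp only [hfix x hx] at hy
      exact hx hy
  have := integral_image_eq_integral_abs_det_fderiv_smul (volume : Measure E)
    Metric.isOpen_ball.measurableSet (fun x (_ : x ∈ Metric.ball (0 : E) R) =>
      (hfd x).hasFDerivWithinAt) hinj.injOn g
  rw [himage] at this
  rw [this]
  simp only [abs_of_pos (hpos _), smul_eq_mul]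

theorem integral_det_mul_one_sub_norm_sq_pow_eq [MeasurableSpace E] [BorelSpace E] {u : E → E}
    (hu : ContDiff ℝ 1 u) {R : ℝ} (hR : ∀ x ∉ Metric.ball (0 : E) R, u x = 0) (a : ℝ) (k : ℕ) :
    ∫ x in Metric.ball 0 R, (ContinuousLinearMap.id ℝ E + fderiv ℝ u x).det *
        (1 - a * ‖x + u x‖ ^ 2) ^ k =
      ∫ x in Metric.ball (0 : E) R, (1 - a * ‖x‖ ^ 2) ^ k := by
  obtain ⟨s₀, hs₀, hs⟩ := exists_forall_integral_det_mul_comp_eq hu hR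
  choose d hd hd' using fun x => exists_polynomial_eval_eq_det_one_add_smul (fderiv ℝ u x)
  let q : E → Polynomial ℝ := fun x => 1 - Polynomial.C a *
    (Polynomial.C (‖x‖ ^ 2) + Polynomial.C (2 * inner ℝ x (u x)) * Polynomial.X +
      Polynomial.C (‖u x‖ ^ 2) * Polynomial.X ^ 2)
  have hq : ∀ x s, (q x).eval s = 1 - a * ‖x + s • u x‖ ^ 2 := by
    intro x s
    rw [norm_add_sq_real, inner_smul_right, norm_smul, mul_pow, Real.norm_eq_abs, sq_abs]
    simp only [q, Polynomial.eval_sub, Polynomial.eval_mul, Polynomial.eval_add,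
      Polynomial.eval_C, Polynomial.eval_pow, Polynomial.eval_X, Polynomial.eval_one]
    ring
  have hqdeg : ∀ x, (q x).natDegree ≤ 2 := fun x => by simp only [q]; compute_degree
  have heval : ∀ x s, (d x * q x ^ k).eval s =
      (ContinuousLinearMap.id ℝ E + s • fderiv ℝ u x).det * (1 - a * ‖x + s • u x‖ ^ 2) ^ k := by
    intro x s
    simp [hq, hd']
  have hcont : ∀ s : ℝ, Continuous fun x =>
      (ContinuousLinearMap.id ℝ E + s • fderiv ℝ u x).det *
        (1 - a * ‖x + s • u x‖ ^ 2) ^ k := by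
    intro s
    have h1 := hu.continuous_fderiv one_ne_zero
    have h2 := hu.continuous
    exact (ContinuousLinearMap.continuous_det.comp (by fun_prop)).mul (by fun_prop)
  have := integral_eval_eq_of_forall_mem_Icc (μ := volume.restrict (Metric.ball (0 : E) R))
    (fun x => d x * q x ^ k) (Module.finrank ℝ E + k * 2)
    (fun x => Polynomial.natDegree_mul_le.trans
      (add_le_add (hd x) (Polynomial.natDegree_pow_le.trans
        (Nat.mul_le_mul_left k (hqdeg x))))) hs₀
    (fun s _ => by
      simp only [heval]
      exact ((hcont s).continuousOn.integrableOn_compact (isCompact_closedBall 0 R)).mono_set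
        Metric.ball_subset_closedBall)
    (fun s hs' => by
      simp only [heval]
      exact hs s hs' fun y => (1 - a * ‖y‖ ^ 2) ^ k) 1
  simpa only [heval, one_smul] using this

/-- A compactly supported `C¹` perturbation of the identity takes the value zero. -/
theorem exists_add_eq_zero {u : E → E} (hu : ContDiff ℝ 1 u) {R : ℝ} (hRpos : 0 < R)
    (hR : ∀ x ∉ Metric.ball (0 : E) R, u x = 0) :
    ∃ x ∈ Metric.closedBall (0 : E) R, x + u x = 0 := by
  by_contra! hne
  borelize E
  have hcont : Continuous fun x => ‖x + u x‖ := by have := hu.continuous; fun_prop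
  have hcpt := isCompact_closedBall (0 : E) R
  have hnon : (Metric.closedBall (0 : E) R).Nonempty := ⟨0, by simp [hRpos.le]⟩
  obtain ⟨x₁, hx₁, hmin⟩ := hcpt.exists_isMinOn hnon hcont.continuousOn
  obtain ⟨x₂, hx₂, hmax⟩ := hcpt.exists_isMaxOn hnon hcont.continuousOn
  have hcontd : Continuous fun x => |(ContinuousLinearMap.id ℝ E + fderiv ℝ u x).det| := by
    have h1 := hu.continuous_fderiv one_ne_zero
    exact (ContinuousLinearMap.continuous_det.comp (by fun_prop)).abs
  obtain ⟨x₃, hx₃, hmaxd⟩ := hcpt.exists_isMaxOn hnon hcontd.continuousOn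
  set δ := min ‖x₁ + u x₁‖ R with hδdef
  set T := max ‖x₂ + u x₂‖ R with hTdef
  set C := |(ContinuousLinearMap.id ℝ E + fderiv ℝ u x₃).det|
  have hδ : 0 < δ := lt_min (norm_pos_iff.2 (hne x₁ hx₁)) hRpos
  have hT : 0 < T := lt_max_of_lt_right hRpos
  have hRT : R ≤ T := le_max_right _ _
  have hδR : δ ≤ R := min_le_right _ _
  have hδT : δ ≤ T := hδR.trans hRT
  set a := (T ^ 2)⁻¹ with ha
  have hapos : 0 < a := by positivity
  have haT : a * T ^ 2 = 1 := inv_mul_cancel₀ (by positivity)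
  have hle1 : ∀ r : ℝ, 0 ≤ r → r ≤ T → a * r ^ 2 ≤ 1 := fun r h0 hr => by
    rw [← haT]; gcongr
  set p := 1 - a * δ ^ 2 with hp
  set q := 1 - a * (δ / 2) ^ 2 with hq
  have hp0 : 0 ≤ p := sub_nonneg.2 (hle1 δ hδ.le hδT)
  have hpq : p < q := by
    simp only [hp, hq]
    have : 0 < a * δ ^ 2 := by positivity
    nlinarith
  have hq0 : 0 < q := hp0.trans_lt hpq
  set V := volume.real (Metric.ball (0 : E) R)
  set W := volume.real (Metric.ball (0 : E) (δ / 2))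
  have hW : 0 < W :=
    ENNReal.toReal_pos (Metric.measure_ball_pos volume _ (by positivity)).ne'
      measure_ball_lt_top.ne
  have hupper : ∀ k : ℕ, ∫ x in Metric.ball 0 R,
      (ContinuousLinearMap.id ℝ E + fderiv ℝ u x).det * (1 - a * ‖x + u x‖ ^ 2) ^ k ≤
      C * p ^ k * V := by
    intro k
    refine (Real.le_norm_self _).trans
      (norm_setIntegral_le_of_norm_le_const measure_ball_lt_top fun x hx => ?_)
    have hx' := Metric.ball_subset_closedBall hx
    have h1 : δ ≤ ‖x + u x‖ := (min_le_left _ _).trans (hmin hx')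
    have h2 : ‖x + u x‖ ≤ T := (hmax hx').trans (le_max_left _ _)
    have h3 : 0 ≤ 1 - a * ‖x + u x‖ ^ 2 := sub_nonneg.2 (hle1 _ (norm_nonneg _) h2)
    rw [norm_mul, norm_pow, Real.norm_of_nonneg h3, Real.norm_eq_abs]
    have h4 : 1 - a * ‖x + u x‖ ^ 2 ≤ p := by simp only [hp]; gcongr
    exact mul_le_mul (hmaxd hx') (pow_le_pow_left₀ h3 h4 k) (by positivity) (abs_nonneg _)
  have hlower : ∀ k : ℕ, q ^ k * W ≤ ∫ x in Metric.ball (0 : E) R, (1 - a * ‖x‖ ^ 2) ^ k := by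
    intro k
    have hintegrable : IntegrableOn (fun x : E => (1 - a * ‖x‖ ^ 2) ^ k) (Metric.ball 0 R) :=
      ((by fun_prop : Continuous fun x : E => (1 - a * ‖x‖ ^ 2) ^ k).continuousOn
        |>.integrableOn_compact
        hcpt).mono_set Metric.ball_subset_closedBall
    have hsub : Metric.ball (0 : E) (δ / 2) ⊆ Metric.ball 0 R :=
      Metric.ball_subset_ball (by linarith)
    calc q ^ k * W = ∫ x in Metric.ball (0 : E) (δ / 2), q ^ k := by
          rw [setIntegral_const, smul_eq_mul, mul_comm]
      _ ≤ ∫ x in Metric.ball (0 : E) (δ / 2), (1 - a * ‖x‖ ^ 2) ^ k := by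
          refine setIntegral_mono_on (integrableOn_const measure_ball_lt_top.ne)
            (hintegrable.mono_set hsub) measurableSet_ball fun x hx => ?_
          have : ‖x‖ ≤ δ / 2 := by simpa using (Metric.mem_ball.1 hx).le
          have h4 : q ≤ 1 - a * ‖x‖ ^ 2 := by simp only [hq]; gcongr
          exact pow_le_pow_left₀ hq0.le h4 k
      _ ≤ _ := by
          refine setIntegral_mono_set hintegrable ?_ hsub.eventuallyLE
          filter_upwards [ae_restrict_mem measurableSet_ball] with x hx
          have : ‖x‖ ≤ T := by
            have : ‖x‖ < R := by simpa using hx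
            linarith
          have := hle1 _ (norm_nonneg x) this
          exact pow_nonneg (sub_nonneg.2 this) k
  have hk : ∀ k : ℕ, W ≤ C * V * (p / q) ^ k := by
    intro k
    have := (hlower k).trans
      ((integral_det_mul_one_sub_norm_sq_pow_eq hu hR a k).symm.le.trans (hupper k))
    rw [div_pow, ← mul_div_assoc, le_div_iff₀ (by positivity)]
    linarith
  have hlim : Filter.Tendsto (fun k : ℕ => C * V * (p / q) ^ k) Filter.atTop (nhds (C * V * 0)) :=
    (tendsto_pow_atTop_nhds_zero_of_lt_one (by positivity)
      ((div_lt_one hq0).2 hpq)).const_mul _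
  have := ge_of_tendsto' hlim hk
  linarith

/-- A `C¹` map that is close to the identity on a ball vanishes somewhere in that ball. -/
theorem exists_eq_zero_of_norm_sub_le {G : E → E} {U : Set E} (hU : IsOpen U)
    (hG : ContDiffOn ℝ 1 G U) {r : ℝ} (hr : 0 < r) (hrU : Metric.closedBall 0 r ⊆ U)
    (hclose : ∀ x ∈ Metric.closedBall (0 : E) r, ‖G x - x‖ ≤ r / 4) :
    ∃ x ∈ Metric.closedBall (0 : E) r, G x = 0 := by
  let χ : ContDiffBump (0 : E) := ⟨r / 2, r, by linarith, by linarith⟩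
  have hout : ∀ x ∉ Metric.ball (0 : E) r, χ x • (G x - x) = 0 := by
    intro x hx
    have : χ x = 0 := χ.zero_of_le_dist (by simpa using hx)
    simp [this]
  have hu : ContDiff ℝ 1 fun x => χ x • (G x - x) := by
    rw [contDiff_iff_contDiffAt]
    intro x
    by_cases hx : x ∈ U
    · exact χ.contDiff.contDiffAt.smul ((hG.contDiffAt (hU.mem_nhds hx)).sub contDiffAt_id)
    · have : (fun x => χ x • (G x - x)) =ᶠ[nhds x] fun _ => 0 := by
        have hx' : x ∈ (Metric.closedBall (0 : E) r)ᶜ := fun h => hx (hrU h)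
        filter_upwards [Metric.isClosed_closedBall.isOpen_compl.mem_nhds hx'] with y hy
        exact hout y fun h => hy (Metric.ball_subset_closedBall h)
      exact contDiffAt_const.congr_of_eventuallyEq this
  obtain ⟨x, hx, hx0⟩ := exists_add_eq_zero hu hr hout
  have hχ : χ x = 1 := by
    apply χ.one_of_mem_closedBall
    have h1 : ‖x‖ ≤ r / 4 := by
      calc ‖x‖ = ‖χ x • (G x - x)‖ := by rw [← norm_neg, ← eq_neg_of_add_eq_zero_right hx0]
        _ ≤ 1 * ‖G x - x‖ := by
            rw [norm_smul, Real.norm_of_nonneg χ.nonneg]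
            exact mul_le_mul_of_nonneg_right χ.le_one (norm_nonneg _)
        _ ≤ r / 4 := by rw [one_mul]; exact hclose x hx
    simp only [mem_closedBall_zero_iff]
    exact h1.trans (by simp only [χ]; linarith)
  refine ⟨x, hx, ?_⟩
  simpa [hχ] using hx0

end Covering

/-- A differentiable map with invertible derivative at a point keeps its value there under
uniformly small `C¹` perturbations. -/
theorem exists_isCompact_forall_exists_eq {E F : Type*} [NormedAddCommGroup E] [NormedSpace ℝ E]
    [FiniteDimensional ℝ E] [NormedAddCommGroup F] [NormedSpace ℝ F] {f : E → F} {L : E ≃L[ℝ] F}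
    {x₀ : E} (hf : HasFDerivAt f (L : E →L[ℝ] F) x₀) {U : Set E} (hU : IsOpen U) (hx₀ : x₀ ∈ U) :
    ∃ K ⊆ U, IsCompact K ∧ ∃ ε > 0, ∀ g : E → F, ContDiffOn ℝ 1 g U →
      (∀ x ∈ K, ‖g x - f x‖ ≤ ε) → ∃ x ∈ K, g x = f x₀ := by
  let e := toEuclidean (E := E)
  let φ : EuclideanSpace ℝ (Fin (Module.finrank ℝ E)) → E := fun y => x₀ + e.symm y
  let M : F →L[ℝ] EuclideanSpace ℝ (Fin (Module.finrank ℝ E)) :=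
    (e : E →L[ℝ] _).comp (L.symm : F →L[ℝ] E)
  have hφ : ContDiff ℝ 1 φ := contDiff_const.add e.symm.contDiff
  have hφ0 : φ 0 = x₀ := by simp [φ]
  have hder : HasFDerivAt (fun y => M (f (φ y) - f x₀))
      (ContinuousLinearMap.id ℝ (EuclideanSpace ℝ (Fin (Module.finrank ℝ E)))) 0 := by
    have h1 : HasFDerivAt φ (e.symm : _ →L[ℝ] E) 0 :=
      e.symm.hasFDerivAt.const_add x₀
    have h2 : HasFDerivAt f (L : E →L[ℝ] F) (φ 0) := by rwa [hφ0]
    have h3 := M.hasFDerivAt.comp (0 : EuclideanSpace ℝ (Fin (Module.finrank ℝ E)))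
      ((h2.comp 0 h1).sub_const (f x₀))
    exact h3.congr_fderiv (by ext1 y; simp [M])
  have hUφ : φ ⁻¹' U ∈ nhds (0 : EuclideanSpace ℝ (Fin (Module.finrank ℝ E))) :=
    hφ.continuous.continuousAt.preimage_mem_nhds (by rw [hφ0]; exact hU.mem_nhds hx₀)
  have hsmall := hder.isLittleO.def (show (0 : ℝ) < 1 / 8 by norm_num)
  obtain ⟨r, hr, hrsub⟩ := Metric.nhds_basis_closedBall.mem_iff.1 (Filter.inter_mem hUφ hsmall)
  have hMpos : 0 < ‖M‖ + 1 := by positivity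
  refine ⟨φ '' Metric.closedBall 0 r, ?_, (isCompact_closedBall 0 r).image hφ.continuous,
    r / 8 / (‖M‖ + 1), by positivity, fun g hg hgf => ?_⟩
  · rintro _ ⟨y, hy, rfl⟩
    exact (hrsub hy).1
  · obtain ⟨y, hy, hy0⟩ := exists_eq_zero_of_norm_sub_le
      (G := fun y => M (g (φ y) - f x₀)) (hU.preimage hφ.continuous)
      (M.contDiff.comp_contDiffOn
        ((hg.comp hφ.contDiffOn (Set.mapsTo_preimage φ U)).sub contDiffOn_const)) hr
      (fun y hy => (hrsub hy).1) (fun y hy => by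
        have h1 : ‖M (f (φ y) - f x₀) - y‖ ≤ 1 / 8 * ‖y‖ := by
          simpa [hφ0] using (hrsub hy).2
        have h2 : ‖y‖ ≤ r := by simpa using hy
        have h3 : ‖M (g (φ y) - f (φ y))‖ ≤ r / 8 := by
          calc _ ≤ ‖M‖ * (r / 8 / (‖M‖ + 1)) :=
                M.le_opNorm_of_le (hgf _ ⟨y, hy, rfl⟩)
            _ ≤ (‖M‖ + 1) * (r / 8 / (‖M‖ + 1)) := by gcongr; linarith
            _ = r / 8 := by field_simp
        calc ‖M (g (φ y) - f x₀) - y‖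
            = ‖M (g (φ y) - f (φ y)) + (M (f (φ y) - f x₀) - y)‖ := by
              congr 1; simp only [map_sub]; abel
          _ ≤ _ := norm_add_le _ _
          _ ≤ r / 4 := by linarith)
    refine ⟨φ y, ⟨y, hy, rfl⟩, ?_⟩
    have : e (L.symm (g (φ y) - f x₀)) = 0 := hy0
    rwa [e.map_eq_zero_iff, L.symm.map_eq_zero_iff, sub_eq_zero] at this

universe u v in
/-- A `C¹` map on a nonempty open set cannot be injective if it lowers the dimension. -/
theorem not_injOn_of_finrank_lt (n : ℕ) : ∀ {E : Type u} {F : Type v} [NormedAddCommGroup E]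
    [NormedSpace ℝ E] [FiniteDimensional ℝ E] [NormedAddCommGroup F] [NormedSpace ℝ F]
    [FiniteDimensional ℝ F] {f : E → F} {U : Set E}, Module.finrank ℝ F = n →
    n < Module.finrank ℝ E → IsOpen U → U.Nonempty → ContDiffOn ℝ 1 f U → ¬ Set.InjOn f U := by
  have hconst : ∀ {E : Type u} {F : Type v} [NormedAddCommGroup E]
      [NormedSpace ℝ E] [FiniteDimensional ℝ E] [NormedAddCommGroup F] [NormedSpace ℝ F]
      {f : E → F} {U : Set E}, 0 < Module.finrank ℝ E → IsOpen U → U.Nonempty →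
      ContDiffOn ℝ 1 f U → (∀ x ∈ U, fderiv ℝ f x = 0) → ¬ Set.InjOn f U := by
    intro E F _ _ _ _ _ f U hE hU ⟨x, hx⟩ hf h0 hinj
    have : Nontrivial E := Module.finrank_pos_iff.1 hE
    obtain ⟨r, hr, hrU⟩ := Metric.isOpen_iff.1 hU x hx
    obtain ⟨y, hy, hyx⟩ := (Filter.inter_mem (mem_nhdsWithin_of_mem_nhds
      (Metric.ball_mem_nhds x hr)) (self_mem_nhdsWithin : {x}ᶜ ∈ nhdsWithin x {x}ᶜ) |>
      Filter.nonempty_of_mem)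
    refine hyx (hinj (hrU hy) hx ?_)
    exact Metric.isOpen_ball.is_const_of_fderiv_eq_zero (𝕜 := ℝ)
      (convex_ball x r).isPreconnected ((hf.differentiableOn one_ne_zero).mono hrU)
      (fun z hz => h0 z (hrU hz)) hy (Metric.mem_ball_self hr)
  induction n with
  | zero =>
    intro E F _ _ _ _ _ _ f U hF hE hU hne hf
    have : Subsingleton F := Module.finrank_zero_iff.1 hF
    exact hconst hE hU hne hf fun x _ => Subsingleton.elim _ _
  | succ n ih =>
    intro E F _ _ _ _ _ _ f U hF hE hU hne hf hinj
    by_cases h0 : ∀ x ∈ U, fderiv ℝ f x = 0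
    · exact hconst (by omega) hU hne hf h0 hinj
    push Not at h0
    obtain ⟨x₀, hx₀, hd⟩ := h0
    obtain ⟨e, he⟩ : ∃ e, fderiv ℝ f x₀ e ≠ 0 := by
      by_contra! h
      exact hd (ContinuousLinearMap.ext h)
    obtain ⟨l, hl⟩ := SeparatingDual.exists_eq_one (R := ℝ) he
    set w := fderiv ℝ f x₀ e with hw
    set k : E →L[ℝ] ℝ := l.comp (fderiv ℝ f x₀) with hk
    have hke : k e = 1 := hl
    have hfx₀ : ContDiffAt ℝ 1 f x₀ := hf.contDiffAt (hU.mem_nhds hx₀)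
    let Ψ : E → E := fun x => x - k x • e + l (f x) • e
    have hΨ : ContDiffAt ℝ 1 Ψ x₀ := by
      have := l.contDiff.contDiffAt.comp x₀ hfx₀
      exact (contDiffAt_id.sub (k.contDiff.contDiffAt.smul contDiffAt_const)).add
        (this.smul contDiffAt_const)
    have hΨ' : HasFDerivAt Ψ
        ((ContinuousLinearEquiv.refl ℝ E : E ≃L[ℝ] E) : E →L[ℝ] E) x₀ := by
      have h1 : HasFDerivAt (fun x => l (f x)) k x₀ :=
        l.hasFDerivAt.comp x₀ (hfx₀.differentiableAt one_ne_zero).hasFDerivAt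
      have h2 := ((hasFDerivAt_id x₀).sub (k.hasFDerivAt.smul_const e)).add (h1.smul_const e)
      exact h2.congr_fderiv (by ext y; simp)
    have hst := hΨ.hasStrictFDerivAt' hΨ' one_ne_zero
    set ψ := hΨ.localInverse hΨ' one_ne_zero with hψ
    have hψC : ContDiffAt ℝ 1 ψ (Ψ x₀) := hΨ.to_localInverse hΨ' one_ne_zero
    have hψ0 : ψ (Ψ x₀) = x₀ := hΨ.localInverse_apply_image hΨ' one_ne_zero
    have hev : ∀ᶠ y in nhds (Ψ x₀), ContDiffAt ℝ 1 ψ y ∧ Ψ (ψ y) = y ∧ ψ y ∈ U :=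
      (hψC.eventually (by simp)).and (hst.eventually_right_inverse.and
        (hψC.continuousAt.eventually (by rw [hψ0]; exact hU.mem_nhds hx₀)))
    obtain ⟨W, hWsub, hWo, hWmem⟩ := mem_nhds_iff.1 hev
    have hkΨ : ∀ x, k (Ψ x) = l (f x) := fun x => by simp [Ψ, hke]
    let p : F →L[ℝ] LinearMap.ker (l : F →ₗ[ℝ] ℝ) :=
      (ContinuousLinearMap.id ℝ F - l.smulRight w).codRestrict _ fun y => by simp [hl]
    let τ : LinearMap.ker (k : E →ₗ[ℝ] ℝ) → E := fun y => Ψ x₀ + y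
    have hτ : ContDiff ℝ 1 τ :=
      contDiff_const.add (LinearMap.ker (k : E →ₗ[ℝ] ℝ)).subtypeL.contDiff
    have hlτ : ∀ y, τ y ∈ W → l (f (ψ (τ y))) = l (f x₀) := fun y hy => by
      have h1 : k y = 0 := y.2
      rw [← hkΨ, (hWsub hy).2.1, ← hkΨ]
      simp [τ, h1]
    have hkfin : Module.finrank ℝ (LinearMap.ker (k : E →ₗ[ℝ] ℝ)) + 1 = Module.finrank ℝ E := by
      have h1 := (k : E →ₗ[ℝ] ℝ).finrank_range_add_finrank_ker
      have h2 : LinearMap.range (k : E →ₗ[ℝ] ℝ) = ⊤ :=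
        LinearMap.range_eq_top.2 fun c => ⟨c • e, by simp [hke]⟩
      rw [h2, finrank_top, Module.finrank_self] at h1
      omega
    have hlfin : Module.finrank ℝ (LinearMap.ker (l : F →ₗ[ℝ] ℝ)) + 1 = Module.finrank ℝ F := by
      have h1 := (l : F →ₗ[ℝ] ℝ).finrank_range_add_finrank_ker
      have h2 : LinearMap.range (l : F →ₗ[ℝ] ℝ) = ⊤ :=
        LinearMap.range_eq_top.2 fun c => ⟨c • w, by simp [hl]⟩
      rw [h2, finrank_top, Module.finrank_self] at h1
      omega
    refine ih (f := fun y => p (f (ψ (τ y)))) (U := τ ⁻¹' W) (by omega) (by omega)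
      (hWo.preimage hτ.continuous) ⟨0, by simpa [τ] using hWmem⟩ ?_ ?_
    · refine p.contDiff.comp_contDiffOn (hf.comp (ContDiffOn.comp (t := W) ?_ hτ.contDiffOn
        (Set.mapsTo_preimage τ W)) fun y hy => (hWsub hy).2.2)
      exact fun y hy => (hWsub hy).1.contDiffWithinAt
    · intro y hy y' hy' heq
      have h1 : f (ψ (τ y)) = f (ψ (τ y')) := by
        have := congrArg Subtype.val heq
        simpa [p, hlτ y hy, hlτ y' hy'] using this
      have h2 := congrArg Ψ (hinj (hWsub hy).2.2 (hWsub hy').2.2 h1)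
      rw [(hWsub hy).2.1, (hWsub hy').2.1] at h2
      exact Subtype.ext (add_left_cancel h2)

/-- Parametric Sard theorem in equal dimensions: almost every point of the product is a regular
value of the partial map. -/
theorem addHaar_image_partial_critical_eq_zero {X Y : Type*} [NormedAddCommGroup X]
    [NormedSpace ℝ X] [FiniteDimensional ℝ X] [NormedAddCommGroup Y] [NormedSpace ℝ Y]
    [FiniteDimensional ℝ Y] [MeasurableSpace (X × Y)] [BorelSpace (X × Y)]
    (μ : Measure (X × Y)) [μ.IsAddHaarMeasure] {f : X × Y → Y} {s : Set (X × Y)}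
    (hf : ∀ p ∈ s, DifferentiableAt ℝ f p) :
    μ ((fun p => (p.1, f p)) '' {p ∈ s | ¬ ∃ L : Y ≃L[ℝ] Y,
      HasFDerivAt (fun y => f (p.1, y)) (L : Y →L[ℝ] Y) p.2}) = 0 := by
  refine addHaar_image_eq_zero_of_det_fderivWithin_eq_zero μ
    (f' := fun p => (ContinuousLinearMap.fst ℝ X Y).prod (fderiv ℝ f p))
    (fun p hp => (hasFDerivAt_fst.prodMk (hf p hp.1).hasFDerivAt).hasFDerivWithinAt) ?_
  rintro p ⟨hp, hnot⟩
  by_contra hdet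
  apply hnot
  set M : Y →L[ℝ] Y := (fderiv ℝ f p).comp (ContinuousLinearMap.inr ℝ X Y) with hM
  have hMd : HasFDerivAt (fun y => f (p.1, y)) M p.2 :=
    HasFDerivAt.comp p.2 (hf p hp).hasFDerivAt (hasFDerivAt_prodMk_right p.1 p.2)
  have hMinj : Function.Injective (M : Y →ₗ[ℝ] Y) := by
    rw [injective_iff_map_eq_zero]
    intro y hy
    have hinj : Function.Injective (((ContinuousLinearMap.fst ℝ X Y).prod (fderiv ℝ f p) :
        X × Y →L[ℝ] X × Y) : X × Y →ₗ[ℝ] X × Y) := by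
      rw [← LinearMap.ker_eq_bot]
      by_contra hker
      exact hdet (LinearMap.det_eq_zero_iff_ker_ne_bot.2 hker)
    have : ((0 : X), y) = 0 := hinj (by
      have hy' : (fderiv ℝ f p) (0, y) = 0 := by simpa [hM] using hy
      simp [hy'])
    exact congrArg Prod.snd this
  refine ⟨(LinearEquiv.ofInjectiveEndo _ hMinj).toContinuousLinearEquiv, ?_⟩
  exact hMd.congr_fderiv (by ext y; rfl)

/-- At almost every point, any two affine functions of a family that attain the lower envelope
have the same linear part. -/
theorem ae_eq_of_affine_le {E ι : Type*} [NormedAddCommGroup E] [NormedSpace ℝ E]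
    [FiniteDimensional ℝ E] [MeasurableSpace E] [BorelSpace E] (μ : Measure E)
    [μ.IsAddHaarMeasure] (l : ι → E →L[ℝ] ℝ) (c : ι → ℝ) :
    ∀ᵐ z ∂μ, ∀ i j, (∀ k, l i z + c i ≤ l k z + c k) → (∀ k, l j z + c j ≤ l k z + c k) →
      l i = l j := by
  rcases isEmpty_or_nonempty ι with hι | hι
  · exact Filter.Eventually.of_forall fun z i => isEmptyElim i
  let D : Set E := {z | BddBelow (Set.range fun i => l i z + c i)}
  let V : E → ℝ := fun z => ⨅ i, (l i z + c i)
  have hcomb : ∀ x ∈ D, ∀ y ∈ D, ∀ a b : ℝ, 0 ≤ a → 0 ≤ b → a + b = 1 → ∀ i,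
      a * V x + b * V y ≤ l i (a • x + b • y) + c i := by
    intro x hx y hy a b ha hb hab i
    have h1 := mul_le_mul_of_nonneg_left (ciInf_le hx i) ha
    have h2 := mul_le_mul_of_nonneg_left (ciInf_le hy i) hb
    have h3 : l i (a • x + b • y) + c i = a * (l i x + c i) + b * (l i y + c i) := by
      simp only [map_add, map_smul, smul_eq_mul]
      linear_combination (-c i) * hab
    rw [h3]
    exact add_le_add h1 h2
  have hDconv : Convex ℝ D := by
    intro x hx y hy a b ha hb hab
    refine ⟨a * V x + b * V y, ?_⟩
    rintro _ ⟨i, rfl⟩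
    exact hcomb x hx y hy a b ha hb hab i
  have hconc : ConcaveOn ℝ D V :=
    ⟨hDconv, fun x hx y hy a b ha hb hab => le_ciInf (hcomb x hx y hy a b ha hb hab)⟩
  have hdiff : ∀ᵐ z ∂μ, z ∈ interior D → DifferentiableAt ℝ V z := by
    have hlip := hconc.locallyLipschitzOn_interior
    have hloc : ∀ x ∈ interior D, ∃ C : NNReal, ∃ s, IsOpen s ∧ x ∈ s ∧ LipschitzOnWith C V s := by
      intro x hx
      obtain ⟨C, s, hs, hC⟩ := hlip hx
      rw [isOpen_interior.nhdsWithin_eq hx] at hs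
      obtain ⟨t, hts, hto, hxt⟩ := mem_nhds_iff.1 hs
      exact ⟨C, t, hto, hxt, hC.mono hts⟩
    choose! C s hso hxs hC using hloc
    obtain ⟨t, htD, htc, hcov⟩ := TopologicalSpace.countable_cover_nhdsWithin (s := interior D)
      (f := s) fun x hx => mem_nhdsWithin_of_mem_nhds ((hso x hx).mem_nhds (hxs x hx))
    have : ∀ᵐ z ∂μ, ∀ x ∈ t, z ∈ s x → DifferentiableWithinAt ℝ V (s x) z :=
      (ae_ball_iff htc).2 fun x hx => (ae_restrict_iff' (hso x (htD hx)).measurableSet).1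
        ((hC x (htD hx)).ae_differentiableWithinAt (hso x (htD hx)).measurableSet)
    filter_upwards [this] with z hz hzD
    obtain ⟨x, hx, hzx⟩ := Set.mem_iUnion₂.1 (hcov hzD)
    exact (hz x hx hzx).differentiableAt ((hso x (htD hx)).mem_nhds hzx)
  have hfront : ∀ᵐ z ∂μ, z ∉ frontier D := measure_eq_zero_iff_ae_notMem.1
    (hDconv.addHaar_frontier μ)
  filter_upwards [hdiff, hfront] with z hz hzf
  have key : ∀ i, (∀ k, l i z + c i ≤ l k z + c k) → l i = fderiv ℝ V z := by
    intro i hi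
    have hzD : z ∈ D := ⟨l i z + c i, by rintro _ ⟨k, rfl⟩; exact hi k⟩
    have hzI : z ∈ interior D := by
      by_contra h
      exact hzf ⟨subset_closure hzD, h⟩
    have hmin : IsLocalMin (fun y => l i y + c i - V y) z := by
      filter_upwards [mem_interior_iff_mem_nhds.1 hzI] with y hy
      have h1 : V z = l i z + c i := le_antisymm (ciInf_le hzD i) (le_ciInf hi)
      have h2 : V y ≤ l i y + c i := ciInf_le hy i
      rw [h1]
      linarith
    have := hmin.hasFDerivAt_eq_zero
      (((l i).hasFDerivAt.add_const (c i)).sub (hz hzI).hasFDerivAt)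
    exact sub_eq_zero.1 this
  intro i j hi hj
  rw [key i hi, key j hj]

/-- Difference quotients of a parametrised family approximate its directional derivative
uniformly on compact sets, for all increments in a suitable open set. -/
theorem exists_isOpen_forall_norm_smul_sub_le {X F Z : Type*} [NormedAddCommGroup X]
    [NormedSpace ℝ X] [NormedAddCommGroup F] [NormedSpace ℝ F] [TopologicalSpace Z]
    {h : X → Z → F} {B : Set X} (hB : IsOpen B) {β₀ : X} (hβ₀ : β₀ ∈ B)
    (hd : ∀ π, DifferentiableOn ℝ (fun β => h β π) B)
    (hc : ContinuousOn (fun p : X × Z => fderiv ℝ (fun β => h β p.2) p.1)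
      (B ×ˢ (Set.univ : Set Z)))
    {K : Set Z} (hK : IsCompact K) (u : X) {ε : ℝ} (hε : 0 < ε) :
    ∃ t > (0 : ℝ), ∃ W ⊆ B, IsOpen W ∧ W.Nonempty ∧ ∀ β ∈ W, ∀ π ∈ K,
      ‖t⁻¹ • (h β π - h β₀ π) - fderiv ℝ (fun β => h β π) β₀ u‖ ≤ ε := by
  have hc₀ : Continuous fun π => fderiv ℝ (fun β => h β π) β₀ := by
    rw [← continuousOn_univ]
    exact hc.comp (f := fun π => (β₀, π)) (by fun_prop) fun π _ => ⟨hβ₀, Set.mem_univ _⟩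
  obtain ⟨M, hM⟩ := hK.exists_bound_of_continuousOn hc₀.continuousOn
  have hMpos : 0 < |M| + 1 := by positivity
  have hupos : 0 < ‖u‖ + 1 := by positivity
  set ε' := ε / 2 / (‖u‖ + 1) with hε'
  have hε'pos : 0 < ε' := by positivity
  set ρ := min 1 (ε / 2 / (|M| + 1)) with hρ
  have hρpos : 0 < ρ := by positivity
  have hopen : IsOpen ((B ×ˢ (Set.univ : Set Z)) ∩ (fun p : X × Z =>
      ‖fderiv ℝ (fun β => h β p.2) p.1 - fderiv ℝ (fun β => h β p.2) β₀‖) ⁻¹' Set.Iio ε') :=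
    (hc.sub (hc₀.comp continuous_snd).continuousOn).norm.isOpen_inter_preimage
      (hB.prod isOpen_univ) isOpen_Iio
  obtain ⟨V, V', hV, -, hβV, hKV, hVsub⟩ := generalized_tube_lemma (isCompact_singleton (x := β₀))
    hK hopen (by
      rintro ⟨β, π⟩ ⟨hβ, -⟩
      obtain rfl : β = β₀ := hβ
      exact ⟨⟨hβ₀, Set.mem_univ _⟩, by simpa using hε'pos⟩)
  obtain ⟨δ, hδ, hδsub⟩ := Metric.isOpen_iff.1 (hV.inter hB) β₀ ⟨hβV rfl, hβ₀⟩
  set t := δ / (‖u‖ + 1) with ht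
  have htpos : 0 < t := by positivity
  have htu : t * (‖u‖ + 1) = δ := by rw [ht]; field_simp
  have hball : ∀ β ∈ Metric.ball (β₀ + t • u) (t * ρ), ‖t⁻¹ • (β - β₀) - u‖ < ρ ∧
      ‖β - β₀‖ < δ := by
    intro β hβ
    have h1 : ‖β - (β₀ + t • u)‖ < t * ρ := by simpa [dist_eq_norm] using hβ
    have h2 : t⁻¹ • (β - β₀) - u = t⁻¹ • (β - (β₀ + t • u)) := by
      simp only [smul_sub, smul_add, smul_smul, inv_mul_cancel₀ htpos.ne', one_smul]
      abel
    constructor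
    · rw [h2, norm_smul, norm_inv, Real.norm_of_nonneg htpos.le, inv_mul_lt_iff₀ htpos]
      exact h1
    · calc ‖β - β₀‖ = ‖(β - (β₀ + t • u)) + t • u‖ := by congr 1; abel
        _ ≤ ‖β - (β₀ + t • u)‖ + ‖t • u‖ := norm_add_le _ _
        _ < t * ρ + t * ‖u‖ := by
            rw [norm_smul, Real.norm_of_nonneg htpos.le]; linarith
        _ ≤ t * (‖u‖ + 1) := by
            have : ρ ≤ 1 := min_le_left _ _
            nlinarith
        _ = δ := htu
  refine ⟨t, htpos, Metric.ball (β₀ + t • u) (t * ρ), fun β hβ => ?_, Metric.isOpen_ball,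
    ⟨_, Metric.mem_ball_self (by positivity)⟩, fun β hβ π hπ => ?_⟩
  · exact (hδsub (by simpa [dist_eq_norm] using (hball β hβ).2)).2
  · obtain ⟨h1, h2⟩ := hball β hβ
    set A := fderiv ℝ (fun β => h β π) β₀ with hA
    have hmv : ‖h β π - h β₀ π - A (β - β₀)‖ ≤ ε' * ‖β - β₀‖ :=
      Convex.norm_image_sub_le_of_norm_fderiv_le' (𝕜 := ℝ) (f := fun β => h β π)
        (s := Metric.ball β₀ δ)
        (fun x hx => (hd π).differentiableAt (hB.mem_nhds (hδsub hx).2))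
        (fun x hx => (hVsub (Set.mk_mem_prod (hδsub hx).1 (hKV hπ))).2.le)
        (convex_ball β₀ δ) (Metric.mem_ball_self hδ) (by simpa [dist_eq_norm] using h2)
    have hsplit : t⁻¹ • (h β π - h β₀ π) - A u =
        t⁻¹ • (h β π - h β₀ π - A (β - β₀)) + A (t⁻¹ • (β - β₀) - u) := by
      simp only [map_sub, map_smul, smul_sub]
      abel
    rw [hsplit]
    have hfst : ‖t⁻¹ • (h β π - h β₀ π - A (β - β₀))‖ ≤ ε / 2 := by
      rw [norm_smul, norm_inv, Real.norm_of_nonneg htpos.le, inv_mul_le_iff₀ htpos]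
      calc _ ≤ ε' * ‖β - β₀‖ := hmv
        _ ≤ ε' * (t * (‖u‖ + 1)) := by rw [htu]; gcongr
        _ = t * (ε / 2) := by rw [hε']; field_simp
    have hsnd : ‖A (t⁻¹ • (β - β₀) - u)‖ ≤ ε / 2 := by
      calc _ ≤ ‖A‖ * ‖t⁻¹ • (β - β₀) - u‖ := A.le_opNorm _
        _ ≤ (|M| + 1) * (ε / 2 / (|M| + 1)) := by
            refine mul_le_mul ?_ (h1.le.trans (min_le_right _ _)) (norm_nonneg _) hMpos.le
            linarith [hM π hπ, le_abs_self M]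
        _ = ε / 2 := by field_simp
    linarith [norm_add_le (t⁻¹ • (h β π - h β₀ π - A (β - β₀))) (A (t⁻¹ • (β - β₀) - u))]

theorem clmMatrix_mulVec (dβ dh : ℕ) (L : (Fin dβ → ℝ) →L[ℝ] (Fin dh → ℝ)) (u : Fin dβ → ℝ) :
    clmMatrix dβ dh L *ᵥ u = L u := by
  ext i
  have hsum : L u = ∑ j, L (Pi.single j (u j)) := by rw [← map_sum, Finset.univ_sum_single]
  rw [hsum, Finset.sum_apply, Matrix.mulVec, dotProduct]
  refine Finset.sum_congr rfl fun j _ => ?_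
  have : (Pi.single j (u j) : Fin dβ → ℝ) = u j • Pi.single j 1 := by
    rw [← Pi.single_smul, smul_eq_mul, mul_one]
  rw [this, map_smul, clmMatrix, Matrix.of_apply, Pi.smul_apply, smul_eq_mul, mul_comm]

/-- The point of the graph of `A` above `u`, as a stacked vector. -/
def graphVec {m n : ℕ} (A : Matrix (Fin n) (Fin m) ℝ) (u : Fin m → ℝ) : Fin (m + n) → ℝ :=
  Fin.append u (A *ᵥ u)

theorem append_add_append {m n : ℕ} (a a' : Fin m → ℝ) (c c' : Fin n → ℝ) :
    Fin.append a c + Fin.append a' c' = Fin.append (a + a') (c + c') := by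
  ext i
  refine Fin.addCases (fun i => ?_) (fun i => ?_) i <;> simp

theorem smul_append {m n : ℕ} (t : ℝ) (a : Fin m → ℝ) (c : Fin n → ℝ) :
    t • Fin.append a c = Fin.append (t • a) (t • c) := by
  ext i
  refine Fin.addCases (fun i => ?_) (fun i => ?_) i <;> simp

theorem append_inj {m n : ℕ} {a a' : Fin m → ℝ} {c c' : Fin n → ℝ}
    (h : Fin.append a c = Fin.append a' c') : a = a' ∧ c = c' :=
  Prod.ext_iff.1 ((Fin.appendEquiv m n).injective (a₁ := (a, c)) (a₂ := (a', c')) h)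

theorem dotProduct_append {m n : ℕ} (a a' : Fin m → ℝ) (c c' : Fin n → ℝ) :
    Fin.append a c ⬝ᵥ Fin.append a' c' = a ⬝ᵥ a' + c ⬝ᵥ c' := by
  simp [dotProduct, Fin.sum_univ_add]

theorem weakIdS_mulVec (dβ dh : ℕ) (R : Matrix (Fin (dβ + dh)) (Fin (dβ + dh)) ℝ)
    (A : Matrix (Fin dh) (Fin dβ) ℝ) (u : Fin dβ → ℝ) :
    weakIdS dβ dh R A *ᵥ u = R *ᵥ graphVec A u := by
  rw [weakIdS, ← Matrix.mulVec_mulVec]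
  congr 1
  ext i
  refine Fin.addCases (fun i => ?_) (fun i => ?_) i
  · simp [graphVec, Matrix.mulVec, dotProduct, Matrix.one_apply]
  · simp [graphVec, Matrix.mulVec, dotProduct]

theorem weakIdg_sub_weakIdS_mulVec (dβ dh : ℕ) (R : Matrix (Fin (dβ + dh)) (Fin (dβ + dh)) ℝ)
    (A A₀ : Matrix (Fin dh) (Fin dβ) ℝ) (b u : Fin dβ → ℝ) :
    weakIdg dβ dh R A A₀ b - weakIdS dβ dh R A *ᵥ u =
      R *ᵥ (graphVec A (b - u) - graphVec A₀ b) := by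
  rw [weakIdg, weakIdS_mulVec, ← Matrix.mulVec_sub]
  congr 1
  rw [sub_eq_iff_eq_add, sub_add_eq_add_sub, eq_sub_iff_add_eq]
  simp only [graphVec, append_add_append, Matrix.mulVec_sub]
  congr 1 <;> abel

theorem isUnit_transpose_mul_weakIdS (dβ dh : ℕ)
    {R : Matrix (Fin (dβ + dh)) (Fin (dβ + dh)) ℝ} (hR : R.PosDef)
    (A : Matrix (Fin dh) (Fin dβ) ℝ) :
    IsUnit ((weakIdS dβ dh R A)ᵀ * weakIdS dβ dh R A).det := by
  have hinj : Function.Injective (weakIdS dβ dh R A).mulVec := by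
    intro u v huv
    rw [weakIdS_mulVec, weakIdS_mulVec] at huv
    exact (append_inj (Matrix.mulVec_injective_of_isUnit hR.isUnit huv)).1
  have := Matrix.PosDef.conjTranspose_mul_self (weakIdS dβ dh R A) hinj
  rw [Matrix.conjTranspose_eq_transpose_of_trivial] at this
  exact (Matrix.isUnit_iff_isUnit_det _).1 this.isUnit

/-- The least squares coefficient of `R z + g(π)` on `S(π)`. -/
noncomputable def weakIdCoef (dβ dh : ℕ) (R : Matrix (Fin (dβ + dh)) (Fin (dβ + dh)) ℝ)
    (A A₀ : Matrix (Fin dh) (Fin dβ) ℝ) (b : Fin dβ → ℝ) (z : Fin (dβ + dh) → ℝ) :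
    Fin dβ → ℝ :=
  (((weakIdS dβ dh R A)ᵀ * weakIdS dβ dh R A)⁻¹ * (weakIdS dβ dh R A)ᵀ) *ᵥ
    (R *ᵥ z + weakIdg dβ dh R A A₀ b)

/-- The normal equations. -/
theorem dotProduct_residual_eq_zero (dβ dh : ℕ)
    {R : Matrix (Fin (dβ + dh)) (Fin (dβ + dh)) ℝ} (hR : R.PosDef)
    (A A₀ : Matrix (Fin dh) (Fin dβ) ℝ) (b : Fin dβ → ℝ) (z : Fin (dβ + dh) → ℝ)
    (x : Fin dβ → ℝ) :
    (R *ᵥ z + weakIdg dβ dh R A A₀ b - weakIdS dβ dh R A *ᵥ weakIdCoef dβ dh R A A₀ b z) ⬝ᵥ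
      weakIdS dβ dh R A *ᵥ x = 0 := by
  rw [weakIdCoef]
  set S := weakIdS dβ dh R A
  have hu : IsUnit (Sᵀ * S).det := isUnit_transpose_mul_weakIdS dβ dh hR A
  rw [Matrix.dotProduct_mulVec, ← Matrix.mulVec_transpose, Matrix.mulVec_sub, Matrix.mulVec_mulVec,
    Matrix.mulVec_mulVec, ← Matrix.mul_assoc,
    Matrix.mul_nonsing_inv _ hu, Matrix.one_mul, sub_self, zero_dotProduct]

/-- The linear part of the affine minorants of the profiled objective, one for each value of
the profiled-out coefficient. -/
noncomputable def weakIdSlope (dβ dh : ℕ) (R : Matrix (Fin (dβ + dh)) (Fin (dβ + dh)) ℝ)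
    (A A₀ : Matrix (Fin dh) (Fin dβ) ℝ) (b u : Fin dβ → ℝ) : (Fin (dβ + dh) → ℝ) →L[ℝ] ℝ :=
  LinearMap.toContinuousLinearMap
    ((2 : ℝ) • (dotProductBilin ℝ ℝ (weakIdg dβ dh R A A₀ b - weakIdS dβ dh R A *ᵥ u)) ∘ₗ
      R.mulVecLin)

theorem weakIdSlope_apply (dβ dh : ℕ) (R : Matrix (Fin (dβ + dh)) (Fin (dβ + dh)) ℝ)
    (A A₀ : Matrix (Fin dh) (Fin dβ) ℝ) (b u : Fin dβ → ℝ) (z : Fin (dβ + dh) → ℝ) :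
    weakIdSlope dβ dh R A A₀ b u z =
      2 * ((weakIdg dβ dh R A A₀ b - weakIdS dβ dh R A *ᵥ u) ⬝ᵥ R *ᵥ z) := by
  rfl

/-- The constant part of the affine functions whose lower envelope is the objective. -/
noncomputable def weakIdIntercept (dβ dh : ℕ) (R : Matrix (Fin (dβ + dh)) (Fin (dβ + dh)) ℝ)
    (A A₀ : Matrix (Fin dh) (Fin dβ) ℝ) (b u : Fin dβ → ℝ) : ℝ :=
  (weakIdS dβ dh R A *ᵥ u) ⬝ᵥ (weakIdS dβ dh R A *ᵥ u) -
    2 * (weakIdg dβ dh R A A₀ b ⬝ᵥ (weakIdS dβ dh R A *ᵥ u))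

theorem weakIdSlope_add_intercept (dβ dh : ℕ)
    {R : Matrix (Fin (dβ + dh)) (Fin (dβ + dh)) ℝ} (hR : R.PosDef) {Θ : Type*}
    (A : Θ → Matrix (Fin dh) (Fin dβ) ℝ) (π₀ : Θ) (b : Fin dβ → ℝ) (κ : Θ → ℝ) (π : Θ)
    (u : Fin dβ → ℝ) (z : Fin (dβ + dh) → ℝ) :
    weakIdSlope dβ dh R (A π) (A π₀) b u z +
        (weakIdIntercept dβ dh R (A π) (A π₀) b u + κ π) =
      weakIdQ dβ dh R A π₀ b κ π z +
        (weakIdS dβ dh R (A π) *ᵥ (u - weakIdCoef dβ dh R (A π) (A π₀) b z)) ⬝ᵥ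
        (weakIdS dβ dh R (A π) *ᵥ (u - weakIdCoef dβ dh R (A π) (A π₀) b z)) := by
  have h := dotProduct_residual_eq_zero dβ dh hR (A π) (A π₀) b z
  have h1 := h u
  have h2 := h (weakIdCoef dβ dh R (A π) (A π₀) b z)
  have hP : (weakIdS dβ dh R (A π) * ((weakIdS dβ dh R (A π))ᵀ * weakIdS dβ dh R (A π))⁻¹ *
      (weakIdS dβ dh R (A π))ᵀ) *ᵥ (R *ᵥ z + weakIdg dβ dh R (A π) (A π₀) b) =
      weakIdS dβ dh R (A π) *ᵥ weakIdCoef dβ dh R (A π) (A π₀) b z := by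
    rw [weakIdCoef, Matrix.mulVec_mulVec, Matrix.mul_assoc]
  rw [weakIdSlope_apply, weakIdIntercept, weakIdQ]
  simp only [hP, Matrix.mulVec_sub]
  set S := weakIdS dβ dh R (A π)
  set g := weakIdg dβ dh R (A π) (A π₀) b
  set c := S *ᵥ weakIdCoef dβ dh R (A π) (A π₀) b z
  set s := S *ᵥ u
  set w := R *ᵥ z
  simp only [sub_dotProduct, add_dotProduct, dotProduct_sub] at h1 h2 ⊢
  rw [dotProduct_comm g w, dotProduct_comm s w, dotProduct_comm s c]
  linarith

theorem weakIdQ_le_slope_add_intercept (dβ dh : ℕ)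
    {R : Matrix (Fin (dβ + dh)) (Fin (dβ + dh)) ℝ} (hR : R.PosDef) {Θ : Type*}
    (A : Θ → Matrix (Fin dh) (Fin dβ) ℝ) (π₀ : Θ) (b : Fin dβ → ℝ) (κ : Θ → ℝ) (π : Θ)
    (u : Fin dβ → ℝ) (z : Fin (dβ + dh) → ℝ) :
    weakIdQ dβ dh R A π₀ b κ π z ≤ weakIdSlope dβ dh R (A π) (A π₀) b u z +
        (weakIdIntercept dβ dh R (A π) (A π₀) b u + κ π) := by
  rw [weakIdSlope_add_intercept dβ dh hR A π₀ b κ π u z]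
  exact le_add_of_nonneg_right (Finset.sum_nonneg fun i _ => mul_self_nonneg _)

/-- If two minimisers have equal active slopes, the recentred point lies on both graphs. -/
theorem eq_graphVec_of_slope_eq (dβ dh : ℕ)
    {R : Matrix (Fin (dβ + dh)) (Fin (dβ + dh)) ℝ} (hR : R.PosDef)
    {A₁ A₂ A₀ : Matrix (Fin dh) (Fin dβ) ℝ} (b : Fin dβ → ℝ) (hrank : (A₁ - A₂).rank = dh)
    {z : Fin (dβ + dh) → ℝ}
    (hslope : weakIdSlope dβ dh R A₁ A₀ b (weakIdCoef dβ dh R A₁ A₀ b z) =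
      weakIdSlope dβ dh R A₂ A₀ b (weakIdCoef dβ dh R A₂ A₀ b z)) :
    ∃ v, z - graphVec A₀ b = graphVec A₁ v ∧ A₁ *ᵥ v = A₂ *ᵥ v := by
  have hRinj : Function.Injective R.mulVec := Matrix.mulVec_injective_of_isUnit hR.isUnit
  have hRsymm : Rᵀ = R := by
    rw [← Matrix.conjTranspose_eq_transpose_of_trivial]; exact hR.isHermitian
  have hRdot : ∀ x y, x ⬝ᵥ R *ᵥ y = (R *ᵥ x) ⬝ᵥ y := fun x y => by
    rw [Matrix.dotProduct_mulVec, ← Matrix.mulVec_transpose, hRsymm]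
  have h1 := dotProduct_residual_eq_zero dβ dh hR A₁ A₀ b z
  have h2 := dotProduct_residual_eq_zero dβ dh hR A₂ A₀ b z
  set u₁ := weakIdCoef dβ dh R A₁ A₀ b z
  set u₂ := weakIdCoef dβ dh R A₂ A₀ b z
  have hres : weakIdg dβ dh R A₁ A₀ b - weakIdS dβ dh R A₁ *ᵥ u₁ =
      weakIdg dβ dh R A₂ A₀ b - weakIdS dβ dh R A₂ *ᵥ u₂ := by
    apply hRinj
    refine dotProduct_eq _ _ fun y => ?_
    have := DFunLike.congr_fun hslope y
    rw [weakIdSlope_apply, weakIdSlope_apply, hRdot, hRdot] at this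
    exact mul_left_cancel₀ two_ne_zero this
  have hgraph : graphVec A₁ (b - u₁) = graphVec A₂ (b - u₂) := by
    rw [weakIdg_sub_weakIdS_mulVec, weakIdg_sub_weakIdS_mulVec] at hres
    exact sub_left_injective (hRinj hres)
  obtain ⟨hu, hA⟩ := append_inj hgraph
  rw [← hu] at hA
  simp only [add_sub_assoc] at h1 h2
  rw [← hres] at h2
  set ρ := R *ᵥ z + (weakIdg dβ dh R A₁ A₀ b - weakIdS dβ dh R A₁ *ᵥ u₁) with hρ
  obtain ⟨⟨r, r'⟩, hr⟩ := (Fin.appendEquiv dβ dh).surjective (R *ᵥ ρ)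
  replace hr : Fin.append r r' = R *ᵥ ρ := hr
  have h1' : ∀ x, r ⬝ᵥ x + r' ⬝ᵥ A₁ *ᵥ x = 0 := fun x => by
    have := h1 x
    rw [weakIdS_mulVec, hRdot] at this
    rw [← dotProduct_append, hr]
    exact this
  have h2' : ∀ x, r ⬝ᵥ x + r' ⬝ᵥ A₂ *ᵥ x = 0 := fun x => by
    have := h2 x
    rw [weakIdS_mulVec, hRdot] at this
    rw [← dotProduct_append, hr]
    exact this
  have hsurj : Function.Surjective (A₁ - A₂).mulVecLin := by
    rw [← LinearMap.range_eq_top]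
    apply Submodule.eq_top_of_finrank_eq
    rw [Module.finrank_fin_fun]
    exact hrank
  have hr' : r' = 0 := by
    refine dotProduct_eq_zero _ fun y => ?_
    obtain ⟨x, rfl⟩ := hsurj y
    rw [Matrix.mulVecLin_apply, Matrix.sub_mulVec, dotProduct_sub]
    linarith [h1' x, h2' x]
  have hr0 : r = 0 := by
    refine dotProduct_eq_zero _ fun x => ?_
    simpa [hr'] using h1' x
  have hρ0 : ρ = 0 := by
    apply hRinj
    rw [Matrix.mulVec_zero, ← hr, hr', hr0]
    ext i
    refine Fin.addCases (fun i => ?_) (fun i => ?_) i <;> simp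
  have hz : z + (graphVec A₁ (b - u₁) - graphVec A₀ b) = 0 := by
    apply hRinj
    rw [Matrix.mulVec_add, ← weakIdg_sub_weakIdS_mulVec, ← hρ, hρ0, Matrix.mulVec_zero]
  refine ⟨-(b - u₁), ?_, ?_⟩
  · have : graphVec A₁ (-(b - u₁)) = -graphVec A₁ (b - u₁) := by
      rw [← neg_one_smul ℝ (b - u₁), ← neg_one_smul ℝ (graphVec A₁ _), graphVec, graphVec,
        smul_append, Matrix.mulVec_smul]
    rw [this, eq_neg_iff_add_eq_zero, ← hz]
    abel
  · rw [Matrix.mulVec_neg, Matrix.mulVec_neg, hA]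

/-- A property holding almost everywhere on an open set holds somewhere on each of its nonempty
open subsets. -/
theorem exists_mem_of_ae_restrict_of_isOpen {X : Type*} [TopologicalSpace X] [MeasurableSpace X]
    [OpensMeasurableSpace X] (ν : Measure X) [ν.IsOpenPosMeasure] {B W : Set X} (hB : IsOpen B)
    {p : X → Prop} (hp : ∀ᵐ x ∂(ν.restrict B), p x) (hWB : W ⊆ B) (hW : IsOpen W)
    (hne : W.Nonempty) : ∃ x ∈ W, p x := by
  rw [ae_restrict_iff' hB.measurableSet] at hp
  by_contra! hW'
  refine (hW.measure_pos ν hne).ne' (measure_mono_null (fun x hx => ?_) hp)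
  exact fun hx' => hW' x hx (hx' (hWB hx))

/-- For almost every point `(u, v)`, the value `v` is attained at most once by
`π ↦ h_β(β₀, π) u`, provided almost every increment of the family is injective. -/
theorem ae_forall_fderiv_apply_eq {X Y Z ι : Type*} [NormedAddCommGroup X]
    [NormedSpace ℝ X] [FiniteDimensional ℝ X] [MeasurableSpace X] [BorelSpace X]
    [NormedAddCommGroup Y] [NormedSpace ℝ Y] [FiniteDimensional ℝ Y]
    [MeasurableSpace (X × Y)] [BorelSpace (X × Y)] (μ : Measure (X × Y)) [μ.IsAddHaarMeasure]
    (ν : Measure X) [ν.IsOpenPosMeasure] [TopologicalSpace Z] [T2Space Z] [Countable ι]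
    {q : ι → Y → Z} {U : ι → Set Y} (hU : ∀ i, IsOpen (U i))
    (hq : ∀ i, ContinuousOn (q i) (U i)) (hcov : ∀ π, ∃ i, ∃ w ∈ U i, q i w = π)
    {h : X → Z → Y} {B : Set X} (hB : IsOpen B) {β₀ : X} (hβ₀ : β₀ ∈ B)
    (hd : ∀ π, DifferentiableOn ℝ (fun β => h β π) B)
    (hc : ContinuousOn (fun p : X × Z => fderiv ℝ (fun β => h β p.2) p.1)
      (B ×ˢ (Set.univ : Set Z)))
    (hC1 : ∀ β ∈ B, ∀ i, ContDiffOn ℝ 1 (fun w => h β (q i w)) (U i))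
    (hβC1 : ∀ i, DifferentiableOn ℝ (fun w => fderiv ℝ (fun β => h β (q i w)) β₀) (U i))
    (hinj : ∀ᵐ β ∂(ν.restrict B), Function.Injective fun π => h β π - h β₀ π) :
    ∀ᵐ p ∂μ, ∀ π₁ π₂, fderiv ℝ (fun β => h β π₁) β₀ p.1 = p.2 →
      fderiv ℝ (fun β => h β π₂) β₀ p.1 = p.2 → π₁ = π₂ := by
  let f : ι → X × Y → Y := fun i p => fderiv ℝ (fun β => h β (q i p.2)) β₀ p.1
  have hcrit : ∀ᵐ p ∂μ, ∀ i, p ∉ (fun p => (p.1, f i p)) '' {p ∈ Prod.snd ⁻¹' U i |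
      ¬ ∃ L : Y ≃L[ℝ] Y, HasFDerivAt (fun y => f i (p.1, y)) (L : Y →L[ℝ] Y) p.2} := by
    refine ae_all_iff.2 fun i => measure_eq_zero_iff_ae_notMem.1
      (addHaar_image_partial_critical_eq_zero μ fun p hp => ?_)
    have h1 := ((hβC1 i).differentiableAt ((hU i).mem_nhds hp)).comp p differentiableAt_snd
    exact h1.clm_apply differentiableAt_fst
  filter_upwards [hcrit] with p hp π₁ π₂ h₁ h₂
  by_contra hne
  obtain ⟨O₁, O₂, hO₁, hO₂, hπ₁, hπ₂, hdisj⟩ := t2_separation hne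
  have key : ∀ π, fderiv ℝ (fun β => h β π) β₀ p.1 = p.2 → ∀ O, IsOpen O → π ∈ O →
      ∃ K ⊆ O, IsCompact K ∧ ∃ ε > (0 : ℝ), ∀ t : ℝ, ∀ β ∈ B,
        (∀ π ∈ K, ‖t⁻¹ • (h β π - h β₀ π) - fderiv ℝ (fun β => h β π) β₀ p.1‖ ≤ ε) →
        ∃ π ∈ K, t⁻¹ • (h β π - h β₀ π) = p.2 := by
    intro π hπ O hO hπO
    obtain ⟨i, w, hw, rfl⟩ := hcov π
    obtain ⟨L, hL⟩ : ∃ L : Y ≃L[ℝ] Y,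
        HasFDerivAt (fun y => f i (p.1, y)) (L : Y →L[ℝ] Y) w := by
      by_contra hL
      exact hp i ⟨(p.1, w), ⟨hw, hL⟩, Prod.ext rfl hπ⟩
    obtain ⟨K, hKU, hK, ε, hε, hg⟩ := exists_isCompact_forall_exists_eq hL
      ((hq i).isOpen_inter_preimage (hU i) hO) ⟨hw, hπO⟩
    refine ⟨q i '' K, Set.image_subset_iff.2 fun x hx => (hKU hx).2,
      hK.image_of_continuousOn ((hq i).mono fun x hx => (hKU hx).1), ε, hε,
      fun t β hβ hclose => ?_⟩
    obtain ⟨x, hx, hxv⟩ := hg (fun w => t⁻¹ • (h β (q i w) - h β₀ (q i w)))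
      ((((hC1 β hβ i).sub (hC1 β₀ hβ₀ i)).const_smul _).mono Set.inter_subset_left)
      (fun x hx => hclose _ (Set.mem_image_of_mem _ hx))
    exact ⟨q i x, Set.mem_image_of_mem _ hx, hxv.trans hπ⟩
  obtain ⟨K₁, hK₁O, hK₁, ε₁, hε₁, hg₁⟩ := key π₁ h₁ O₁ hO₁ hπ₁
  obtain ⟨K₂, hK₂O, hK₂, ε₂, hε₂, hg₂⟩ := key π₂ h₂ O₂ hO₂ hπ₂
  obtain ⟨t, ht, W, hWB, hW, hWne, hclose⟩ := exists_isOpen_forall_norm_smul_sub_le hB hβ₀ hd hc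
    (hK₁.union hK₂) p.1 (lt_min hε₁ hε₂)
  obtain ⟨β, hβW, hβinj⟩ := exists_mem_of_ae_restrict_of_isOpen ν hB hinj hWB hW hWne
  obtain ⟨x₁, hx₁, he₁⟩ := hg₁ t β (hWB hβW)
    fun π hπ => (hclose β hβW π (Or.inl hπ)).trans (min_le_left _ _)
  obtain ⟨x₂, hx₂, he₂⟩ := hg₂ t β (hWB hβW)
    fun π hπ => (hclose β hβW π (Or.inr hπ)).trans (min_le_right _ _)
  have hx : x₁ = x₂ :=
    hβinj (smul_right_injective Y (inv_ne_zero ht.ne') (he₁.trans he₂.symm))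
  exact Set.disjoint_left.1 hdisj (hK₁O hx₁) (hx ▸ hK₂O hx₂)

theorem contDiffOn_comp_chart_symm {m : ℕ} {M F : Type*} [TopologicalSpace M]
    [ChartedSpace (EuclideanSpace ℝ (Fin m)) M] [IsManifold (𝓡 m) 1 M] [NormedAddCommGroup F]
    [NormedSpace ℝ F] {g : M → F} (hg : ContMDiff (𝓡 m) 𝓘(ℝ, F) 1 g) (x : M) :
    ContDiffOn ℝ 1 (fun y => g ((chartAt (EuclideanSpace ℝ (Fin m)) x).symm y))
      (chartAt (EuclideanSpace ℝ (Fin m)) x).target :=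
  contMDiffOn_iff_contDiffOn.1 (hg.comp_contMDiffOn contMDiffOn_chart_symm)

/-- The projection of `ℝⁿ` onto the Euclidean space of its first `m` coordinates. -/
noncomputable def truncateEuclidean {m n : ℕ} (hmn : m ≤ n) :
    (Fin n → ℝ) →L[ℝ] EuclideanSpace ℝ (Fin m) :=
  ((EuclideanSpace.equiv (Fin m) ℝ).symm : (Fin m → ℝ) →L[ℝ] EuclideanSpace ℝ (Fin m)).comp
    (LinearMap.toContinuousLinearMap (LinearMap.funLeft ℝ ℝ (Fin.castLE hmn)))

theorem truncateEuclidean_surjective {m n : ℕ} (hmn : m ≤ n) :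
    Function.Surjective (truncateEuclidean hmn) :=
  (EuclideanSpace.equiv (Fin m) ℝ).symm.surjective.comp
    (LinearMap.funLeft_surjective_of_injective ℝ ℝ _ (Fin.castLE_injective hmn))

/-- A manifold with a `C¹` injection into `ℝⁿ` has dimension at most `n`. -/
theorem dim_le_of_contMDiff_injective {m n : ℕ} {M : Type*} [TopologicalSpace M]
    [ChartedSpace (EuclideanSpace ℝ (Fin m)) M] [IsManifold (𝓡 m) 1 M]
    {g : M → Fin n → ℝ} (hg : ContMDiff (𝓡 m) 𝓘(ℝ, Fin n → ℝ) 1 g)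
    (hinj : Function.Injective g) (x : M) : m ≤ n := by
  by_contra! hlt
  set e := chartAt (EuclideanSpace ℝ (Fin m)) x
  refine not_injOn_of_finrank_lt n (Module.finrank_fin_fun ℝ) (by simpa using hlt)
    e.open_target ⟨e x, e.map_source (mem_chart_source _ x)⟩ (contDiffOn_comp_chart_symm hg x) ?_
  exact fun y hy y' hy' hyy' => e.symm.injOn hy hy' (hinj hyy')

/-- A countable union of second countable manifolds of dimension at most `n` is covered by
countably many `C¹` images of open subsets of `ℝⁿ`. -/
theorem exists_countable_parametrization {J : Type*} [Countable J] {dj : J → ℕ} {Θ : J → Type*}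
    [∀ j, TopologicalSpace (Θ j)] [∀ j, SecondCountableTopology (Θ j)]
    [∀ j, ChartedSpace (EuclideanSpace ℝ (Fin (dj j))) (Θ j)]
    [∀ j, IsManifold (𝓡 (dj j)) 1 (Θ j)] {n : ℕ} (hn : ∀ j, Θ j → dj j ≤ n) :
    ∃ t : ∀ j, Set (Θ j), (∀ j, (t j).Countable) ∧
      ∃ q : (Σ j, t j) → (Fin n → ℝ) → Σ j, Θ j, ∃ U : (Σ j, t j) → Set (Fin n → ℝ),
      (∀ i, IsOpen (U i)) ∧ (∀ i, ContinuousOn (q i) (U i)) ∧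
      (∀ π, ∃ i, ∃ w ∈ U i, q i w = π) ∧
      ∀ i, ∃ (e : (Fin n → ℝ) →L[ℝ] EuclideanSpace ℝ (Fin (dj i.1))),
        (∀ w, q i w = ⟨i.1, (chartAt (EuclideanSpace ℝ (Fin (dj i.1))) i.2.1).symm (e w)⟩) ∧
        U i = e ⁻¹' (chartAt (EuclideanSpace ℝ (Fin (dj i.1))) i.2.1).target := by
  have hcover : ∀ j, ∃ t : Set (Θ j), t.Countable ∧
      ⋃ x ∈ t, (chartAt (EuclideanSpace ℝ (Fin (dj j))) x).source = Set.univ :=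
    fun j => TopologicalSpace.countable_cover_nhds fun x => chart_source_mem_nhds _ x
  choose t ht hcov using hcover
  refine ⟨t, ht, fun i w => ⟨i.1, (chartAt (EuclideanSpace ℝ (Fin (dj i.1))) i.2.1).symm
    (truncateEuclidean (hn i.1 i.2) w)⟩, fun i => truncateEuclidean (hn i.1 i.2) ⁻¹'
      (chartAt (EuclideanSpace ℝ (Fin (dj i.1))) i.2.1).target, fun i => ?_, fun i => ?_, ?_,
    fun i => ⟨_, fun w => rfl, rfl⟩⟩
  · exact (OpenPartialHomeomorph.open_target _).preimage (ContinuousLinearMap.continuous _)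
  · exact continuous_sigmaMk.comp_continuousOn ((OpenPartialHomeomorph.continuousOn_symm _).comp
      (ContinuousLinearMap.continuous _).continuousOn (Set.mapsTo_preimage _ _))
  · rintro ⟨j, x⟩
    have hx : x ∈ ⋃ y ∈ t j, (chartAt (EuclideanSpace ℝ (Fin (dj j))) y).source := by
      rw [hcov]; trivial
    obtain ⟨y, hy, hxy⟩ := Set.mem_iUnion₂.1 hx
    set e := chartAt (EuclideanSpace ℝ (Fin (dj j))) y with he
    obtain ⟨w, hw⟩ := truncateEuclidean_surjective (hn j y) (e x)
    refine ⟨⟨j, y, hy⟩, w, ?_, ?_⟩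
    · change truncateEuclidean (hn j y) w ∈ e.target
      rw [hw]
      exact e.map_source hxy
    · change (⟨j, e.symm (truncateEuclidean (hn j y) w)⟩ : Σ j, Θ j) = ⟨j, x⟩
      rw [hw, e.left_inv hxy]

/-- Stacking two vectors, as a linear isomorphism. -/
noncomputable def stackEquiv (m n : ℕ) :
    ((Fin m → ℝ) × (Fin n → ℝ)) ≃L[ℝ] (Fin (m + n) → ℝ) :=
  LinearEquiv.toContinuousLinearEquiv
    { Fin.appendEquiv m n with
      map_add' := fun x y => (append_add_append x.1 y.1 x.2 y.2).symm
      map_smul' := fun t x => (smul_append t x.1 x.2).symm }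

theorem stackEquiv_apply {m n : ℕ} (x : (Fin m → ℝ) × (Fin n → ℝ)) :
    stackEquiv m n x = Fin.append x.1 x.2 := rfl

/-- An almost sure property of pairs holds almost surely for the blocks of a recentred stacked
vector. -/
theorem ae_stack_sub {m n : ℕ} {p : (Fin m → ℝ) × (Fin n → ℝ) → Prop}
    (hp : ∀ᵐ x ∂((volume : Measure (Fin m → ℝ)).prod (volume : Measure (Fin n → ℝ))), p x)
    (c : Fin (m + n) → ℝ) :
    ∀ᵐ z, ∀ u v, z - c = Fin.append u v → p (u, v) := by
  have h1 : ∀ᵐ y : Fin (m + n) → ℝ, p ((stackEquiv m n).symm y) := by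
    have := Measure.prod.instIsAddHaarMeasure (volume : Measure (Fin m → ℝ))
      (volume : Measure (Fin n → ℝ))
    have := (stackEquiv m n).symm.isAddHaarMeasure_map (volume : Measure (Fin (m + n) → ℝ))
    exact ae_of_ae_map (stackEquiv m n).symm.continuous.aemeasurable
      ((Measure.absolutelyContinuous_isAddHaarMeasure _ _).ae_le hp)
  filter_upwards [(measurePreserving_sub_right volume c).quasiMeasurePreserving.ae h1]
    with z hz u v huv
  rwa [huv, ← stackEquiv_apply (u, v), ContinuousLinearEquiv.symm_apply_apply] at hz

/-- Theorem 4: almost sure uniqueness of the argmin of the limiting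
profiled objective function under weak identification. -/
theorem weakId_argmin_unique (dβ dh : ℕ) (hdβ : 1 ≤ dβ) (hdh : 1 ≤ dh)
    {J : Type*} [Countable J] (dj : J → ℕ)
    (Θ : J → Type*) [∀ j, TopologicalSpace (Θ j)] [∀ j, T2Space (Θ j)]
    [∀ j, SecondCountableTopology (Θ j)]
    [∀ j, ChartedSpace (EuclideanSpace ℝ (Fin (dj j))) (Θ j)]
    [∀ j, HasGroupoid (Θ j) (contDiffGroupoid 1 (𝓡 (dj j)))]
    (B : Set (Fin dβ → ℝ)) (hB : IsOpen B) (β₀ : Fin dβ → ℝ) (hβ₀ : β₀ ∈ B)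
    (h : (Fin dβ → ℝ) → (Σ j, Θ j) → (Fin dh → ℝ))
    (hh2 : ∀ π : Σ j, Θ j, ContDiffOn ℝ 2 (fun β => h β π) B)
    (hhcont : ContinuousOn (fun p : (Fin dβ → ℝ) × (Σ j, Θ j) => h p.1 p.2)
      (B ×ˢ (Set.univ : Set (Σ j, Θ j))))
    (hhβcont : ContinuousOn
      (fun p : (Fin dβ → ℝ) × (Σ j, Θ j) => fderiv ℝ (fun β => h β p.2) p.1)
      (B ×ˢ (Set.univ : Set (Σ j, Θ j))))
    (hπC1 : ∀ β ∈ B, ∀ j, ContMDiff (𝓡 (dj j)) 𝓘(ℝ, Fin dh → ℝ) 1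
      (fun x : Θ j => h β ⟨j, x⟩))
    (hβπC1 : ∀ j, ContMDiff (𝓡 (dj j)) 𝓘(ℝ, (Fin dβ → ℝ) →L[ℝ] (Fin dh → ℝ)) 1
      (fun x : Θ j => fderiv ℝ (fun β => h β ⟨j, x⟩) β₀))
    (π₀ : Σ j, Θ j) (b : Fin dβ → ℝ)
    (βseq : ℕ → (Fin dβ → ℝ)) (hβseqB : ∀ n, βseq n ∈ B)
    (hβseqlim : Filter.Tendsto βseq Filter.atTop (nhds β₀))
    (hweak : ∀ K : Set (Σ j, Θ j), IsCompact K →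
      TendstoUniformlyOn
        (fun (n : ℕ) π => Real.sqrt n • (h (βseq n) π - h β₀ π))
        (fun π => fderiv ℝ (fun β => h β π) β₀ b) Filter.atTop K)
    (hrank : ∀ π₁ π₂ : Σ j, Θ j, π₁ ≠ π₂ →
      (clmMatrix dβ dh (fderiv ℝ (fun β => h β π₁) β₀) -
       clmMatrix dβ dh (fderiv ℝ (fun β => h β π₂) β₀)).rank = dh)
    (hinj : ∀ᵐ β ∂(volume.restrict B),
      Function.Injective (fun π : Σ j, Θ j => h β π - h β₀ π))
    (H : Matrix (Fin (dβ + dh)) (Fin (dβ + dh)) ℝ) (hHsymm : H.IsSymm) (hHpd : H.PosDef)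
    (Hhalf : Matrix (Fin (dβ + dh)) (Fin (dβ + dh)) ℝ) (hHhalfpd : Hhalf.PosDef)
    (hHsq : Hhalf * Hhalf = H)
    (κ : (Σ j, Θ j) → ℝ) (hκ : Continuous κ)
    (P : Measure (Fin (dβ + dh) → ℝ)) [IsProbabilityMeasure P] (hP : P ≪ volume) :
    ∀ᵐ z ∂P, ∀ π₁ π₂ : Σ j, Θ j,
      (∀ π : Σ j, Θ j,
        weakIdQ dβ dh Hhalf (fun π' => clmMatrix dβ dh (fderiv ℝ (fun β => h β π') β₀))
          π₀ b κ π₁ z ≤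
        weakIdQ dβ dh Hhalf (fun π' => clmMatrix dβ dh (fderiv ℝ (fun β => h β π') β₀))
          π₀ b κ π z) →
      (∀ π : Σ j, Θ j,
        weakIdQ dβ dh Hhalf (fun π' => clmMatrix dβ dh (fderiv ℝ (fun β => h β π') β₀))
          π₀ b κ π₂ z ≤
        weakIdQ dβ dh Hhalf (fun π' => clmMatrix dβ dh (fderiv ℝ (fun β => h β π') β₀))
          π₀ b κ π z) →
      π₁ = π₂ := by
  have : ∀ j, IsManifold (𝓡 (dj j)) 1 (Θ j) := fun j => IsManifold.mk' _ _ _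
  have hd : ∀ π, DifferentiableOn ℝ (fun β => h β π) B :=
    fun π => (hh2 π).differentiableOn two_ne_zero
  have hn : ∀ j, Θ j → dj j ≤ dh := by
    intro j x
    obtain ⟨β, hβ, hβinj⟩ := exists_mem_of_ae_restrict_of_isOpen volume hB hinj subset_rfl hB
      ⟨β₀, hβ₀⟩
    exact dim_le_of_contMDiff_injective ((hπC1 β hβ j).sub (hπC1 β₀ hβ₀ j))
      (hβinj.comp sigma_mk_injective) x
  obtain ⟨t, ht, q, U, hU, hq, hcov, he⟩ := exists_countable_parametrization hn
  have : ∀ j, Countable (t j) := fun j => (ht j).to_subtype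
  have hC1 : ∀ {F : Type} [NormedAddCommGroup F] [NormedSpace ℝ F] {g : (Σ j, Θ j) → F},
      (∀ j, ContMDiff (𝓡 (dj j)) 𝓘(ℝ, F) 1 fun x : Θ j => g ⟨j, x⟩) →
      ∀ i, ContDiffOn ℝ 1 (fun w => g (q i w)) (U i) := by
    intro F _ _ g hg i
    obtain ⟨e, hqe, hUe⟩ := he i
    simp only [hqe, hUe]
    exact (contDiffOn_comp_chart_symm (hg i.1) i.2.1).comp e.contDiff.contDiffOn
      (Set.mapsTo_preimage _ _)
  have := Measure.prod.instIsAddHaarMeasure (volume : Measure (Fin dβ → ℝ))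
    (volume : Measure (Fin dh → ℝ))
  have huniq := ae_stack_sub (ae_forall_fderiv_apply_eq
    ((volume : Measure (Fin dβ → ℝ)).prod (volume : Measure (Fin dh → ℝ))) volume hU hq hcov hB
    hβ₀ hd hhβcont (fun β hβ => hC1 (hπC1 β hβ))
    (fun i => (hC1 (g := fun π => fderiv ℝ (fun β => h β π) β₀)
      hβπC1 i).differentiableOn one_ne_zero) hinj)
    (graphVec (clmMatrix dβ dh (fderiv ℝ (fun β => h β π₀) β₀)) b)
  set A : (Σ j, Θ j) → Matrix (Fin dh) (Fin dβ) ℝ :=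
    fun π => clmMatrix dβ dh (fderiv ℝ (fun β => h β π) β₀) with hA
  have hslope := ae_eq_of_affine_le (volume : Measure (Fin (dβ + dh) → ℝ))
    (fun k : (Σ j, Θ j) × (Fin dβ → ℝ) => weakIdSlope dβ dh Hhalf (A k.1) (A π₀) b k.2)
    (fun k => weakIdIntercept dβ dh Hhalf (A k.1) (A π₀) b k.2 + κ k.1)
  filter_upwards [hP.ae_le huniq, hP.ae_le hslope] with z hz hzs π₁ π₂ h₁ h₂
  have hactive : ∀ π, (∀ π', weakIdQ dβ dh Hhalf A π₀ b κ π z ≤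
      weakIdQ dβ dh Hhalf A π₀ b κ π' z) → ∀ k : (Σ j, Θ j) × (Fin dβ → ℝ),
      weakIdSlope dβ dh Hhalf (A π) (A π₀) b (weakIdCoef dβ dh Hhalf (A π) (A π₀) b z) z +
        (weakIdIntercept dβ dh Hhalf (A π) (A π₀) b
          (weakIdCoef dβ dh Hhalf (A π) (A π₀) b z) + κ π) ≤
      weakIdSlope dβ dh Hhalf (A k.1) (A π₀) b k.2 z +
        (weakIdIntercept dβ dh Hhalf (A k.1) (A π₀) b k.2 + κ k.1) := by
    intro π hπ k
    rw [weakIdSlope_add_intercept dβ dh hHhalfpd, sub_self, Matrix.mulVec_zero,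
      zero_dotProduct, add_zero]
    exact (hπ k.1).trans (weakIdQ_le_slope_add_intercept dβ dh hHhalfpd A π₀ b κ k.1 k.2 z)
  by_contra hne
  obtain ⟨v, hzv, hv⟩ := eq_graphVec_of_slope_eq dβ dh hHhalfpd b (hrank π₁ π₂ hne)
    (hzs (π₁, weakIdCoef dβ dh Hhalf (A π₁) (A π₀) b z)
      (π₂, weakIdCoef dβ dh Hhalf (A π₂) (A π₀) b z) (hactive π₁ h₁) (hactive π₂ h₂))
  refine hne (hz v (A π₁ *ᵥ v) hzv π₁ π₂ ?_ ?_)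
  · exact (clmMatrix_mulVec dβ dh _ v).symm
  · exact (clmMatrix_mulVec dβ dh _ v).symm.trans hv.symm
end
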